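/- arXiv:2104.10314 — 2 statements merged into one kernel-verified Lean document; each statement's English description precedes it below -/
import Mathlib

section
/- (Approximate recovery at Stage One.) There exist positive absolute constants c₃ and C₃ such that the following holds. Let x₁,…,x_L ∈ ℝ^N be i.i.d. Bernoulli–Gaussian vectors with parameter θ ∈ (1/N, (1/12)√(π/2)), set y_i = x_i. Fix ζ₀ ∈ (0,1), n ∈ {1,…,N}, and an initialization d^{(0)} ∈ S_{ζ₀}^{(n+)} (resp. S_{ζ₀}^{(n−)}). Whenever ε ∈ (0, c₃(1+ζ₀)N^{1/2}/(ζ₀ θ^{5/2}(log(L) log(NL))^{3/2})) and L ≥ C₃ ((1+ζ₀)/ζ₀)² (N⁵/(θ³ ε²)) log((1+ζ₀)N/(ζ₀ θ ε)), with probability at least 1 − c L^{−1} for an absolute constant c, the GPM iterates d^{(t+1)} = g^{(t)}/‖g^{(t)}‖ with g^{(t)} = (3/L) Σ_{i=1}^L ((d^{(t)})ᵀ y_i)|(d^{(t)})ᵀ y_i| y_i converge to a point r satisfying ‖r − e_n‖ ≤ ε (resp. ‖r − (−e_n)‖ ≤ ε). -/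
open MeasureTheory ProbabilityTheory Real Filter Topology

/-- The Bernoulli–Gaussian distribution BG(θ) on ℝ. -/
noncomputable def bgMeasure (θ : ℝ) : Measure ℝ :=
  (1 - θ).toNNReal • Measure.dirac 0 + θ.toNNReal • gaussianReal 0 1

instance (θ : ℝ) : IsFiniteMeasure (bgMeasure θ) := by
  unfold bgMeasure; infer_instance

/-- The law of a Bernoulli–Gaussian random vector x ∈ ℝ^N with i.i.d. BG(θ) coordinates. -/
noncomputable def bgPi (θ : ℝ) (N : ℕ) : Measure (Fin N → ℝ) :=
  Measure.pi fun _ => bgMeasure θ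

/-- The joint law of L i.i.d. samples y_i = x_i, x_i ~ BG(θ)^N (dictionary D* = I). -/
noncomputable def bgSamples (θ : ℝ) (N L : ℕ) : Measure (Fin L → Fin N → ℝ) :=
  Measure.pi fun _ => bgPi θ N

/-- g(d)_j = (3/L) Σᵢ (dᵀyᵢ)|dᵀyᵢ| (yᵢ)_j. -/
noncomputable def empG (N L : ℕ) (ω : Fin L → Fin N → ℝ) (d : Fin N → ℝ)
    (j : Fin N) : ℝ :=
  ((3 : ℝ) / L) * ∑ i, (∑ k, d k * ω i k) * |∑ k, d k * ω i k| * ω i j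

/-- One GPM step: d ↦ g(d)/‖g(d)‖. -/
noncomputable def gpmStep (N L : ℕ) (ω : Fin L → Fin N → ℝ) (d : Fin N → ℝ) :
    Fin N → ℝ :=
  fun j => empG N L ω d j / Real.sqrt (∑ k, empG N L ω d k ^ 2)

/-- The GPM iterates d^{(t)} started from d₀. -/
noncomputable def gpmIter (N L : ℕ) (ω : Fin L → Fin N → ℝ) (d₀ : Fin N → ℝ)
    (t : ℕ) : Fin N → ℝ :=
  (gpmStep N L ω)^[t] d₀

/-- Membership in the good subset S_ζ^{(n,s)} (s = +1 or −1). -/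
def goodSet (N : ℕ) (ζ : ℝ) (n : Fin N) (s : ℝ) (d : Fin N → ℝ) : Prop :=
  (∑ i, d i ^ 2 = 1) ∧ 0 < s * d n ∧ ∀ j ≠ n, (1 + ζ) * d j ^ 2 ≤ d n ^ 2

lemma sard_countable {n : ℕ} (f : (Fin n → ℝ) → (Fin n → ℝ)) (U : Set (Fin n → ℝ))
    (hf : ∀ x ∈ U, DifferentiableAt ℝ f x) :
    ∀ᵐ w : Fin n → ℝ, {v | v ∈ U ∧ f v = w}.Countable := by
  set s : Set (Fin n → ℝ) := {x | x ∈ U ∧ (fderiv ℝ f x).det = 0} with hs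
  have h0 : volume (f '' s) = 0 := by
    apply addHaar_image_eq_zero_of_det_fderivWithin_eq_zero volume (f' := fderiv ℝ f)
    · intro x hx
      exact (hf x hx.1).hasFDerivAt.hasFDerivWithinAt
    · intro x hx; exact hx.2
  have h1 : ∀ᵐ w : Fin n → ℝ, w ∉ f '' s := by
    exact measure_eq_zero_iff_ae_notMem.mp h0
  filter_upwards [h1] with w hw
  have hdisc : DiscreteTopology {v | v ∈ U ∧ f v = w} := by
    rw [← isDiscrete_iff_discreteTopology, isDiscrete_iff_forall_mem_exists_isOpen]
    rintro x ⟨hxU, hxw⟩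
    have hdet : (fderiv ℝ f x).det ≠ 0 := fun h => hw ⟨x, ⟨hxU, h⟩, hxw⟩
    have hev : ∀ᶠ z in 𝓝[≠] x, f z ≠ w := by
      apply (hf x hxU).hasFDerivAt.eventually_ne
      set e := ContinuousLinearMap.toContinuousLinearEquivOfDetNeZero (fderiv ℝ f x) hdet
      exact ⟨_, e.antilipschitz⟩
    rw [eventually_nhdsWithin_iff, eventually_nhds_iff] at hev
    obtain ⟨t, ht, hto, hxt⟩ := hev
    refine ⟨t, hto, ?_⟩
    ext y
    constructor
    · rintro ⟨hy, hyU, hyw⟩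
      by_contra hne
      exact ht y hy hne hyw
    · rintro rfl
      exact ⟨hxt, hxU, hxw⟩
  have : Countable {v | v ∈ U ∧ f v = w} :=
    TopologicalSpace.separableSpace_iff_countable.mp inferInstance
  exact this

lemma mul_abs_differentiableAt {y : ℝ} (hy : y ≠ 0) :
    DifferentiableAt ℝ (fun z : ℝ => z * |z|) y :=
  differentiableAt_id.mul (differentiableAt_abs hy)

lemma weights_countable {L : ℕ} (G : Fin L → Fin L → ℝ) :
    ∀ᵐ w : Fin L → ℝ,
      {v : Fin L → ℝ | ∀ i, v i = w i * ((∑ k, G i k * v k) * |∑ k, G i k * v k|)}.Countable := by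
  classical
  set Θ : Finset (Fin L) → (Fin L → ℝ) → (Fin L → ℝ) := fun A v i =>
    if i ∈ A then v i / ((∑ k ∈ A, G i k * v k) * |∑ k ∈ A, G i k * v k|) else v i with hΘ
  set U : Finset (Fin L) → Set (Fin L → ℝ) := fun A => {v | ∀ i ∈ A, ∑ k ∈ A, G i k * v k ≠ 0}
  have hd : ∀ A, ∀ᵐ w : Fin L → ℝ, {v | v ∈ U A ∧ Θ A v = w}.Countable := by
    intro A
    apply sard_countable
    intro x hx
    rw [differentiableAt_pi]
    intro i
    by_cases hi : i ∈ A
    · simp only [hΘ, hi, if_true]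
      have h1 : DifferentiableAt ℝ (fun v : Fin L → ℝ => ∑ k ∈ A, G i k * v k) x := by fun_prop
      have h2 := (mul_abs_differentiableAt (hx i hi)).comp x h1
      have hne : (∑ k ∈ A, G i k * x k) * |∑ k ∈ A, G i k * x k| ≠ 0 :=
        mul_ne_zero (hx i hi) (abs_ne_zero.mpr (hx i hi))
      have h3 := (differentiableAt_inv (𝕜 := ℝ) hne).comp x h2
      have h4 := (differentiableAt_apply (𝕜 := ℝ) i x).mul h3
      simpa only [div_eq_mul_inv] using! h4
    · simp only [hΘ, hi, if_false]; fun_prop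
  have hall : ∀ᵐ w : Fin L → ℝ, ∀ A, {v | v ∈ U A ∧ Θ A v = w}.Countable := ae_all_iff.mpr hd
  filter_upwards [hall] with w hw
  have hc : (⋃ A : Finset (Fin L), (fun v : Fin L → ℝ => fun i => if i ∈ A then v i else 0) ''
      {v | v ∈ U A ∧ Θ A v = w}).Countable :=
    Set.countable_iUnion fun A => (hw A).image _
  refine hc.mono ?_
  intro v hv
  simp only [Set.mem_ofPred_eq] at hv
  set A : Finset (Fin L) := Finset.univ.filter fun i => ∑ k, G i k * v k ≠ 0 with hA
  have hv0 : ∀ i, i ∉ A → v i = 0 := by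
    intro i hi
    have : ∑ k, G i k * v k = 0 := by simpa [hA] using hi
    rw [hv i, this]; simp
  set v' : Fin L → ℝ := fun i => if i ∈ A then v i else w i with hv'
  have hsum : ∀ i, ∑ k ∈ A, G i k * v' k = ∑ k, G i k * v k := by
    intro i
    rw [← Finset.sum_subset (Finset.subset_univ A)]
    · apply Finset.sum_congr rfl
      intro k hk; simp [hv', hk]
    · intro k _ hk; simp [hv0 k hk]
  refine Set.mem_iUnion.mpr ⟨A, v', ⟨?_, ?_⟩, ?_⟩
  · intro i hi
    rw [hsum]; simpa [hA] using hi
  · funext i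
    by_cases hi : i ∈ A
    · have hne : ∑ k, G i k * v k ≠ 0 := by simpa [hA] using hi
      simp only [hΘ, hi, if_true]
      rw [hsum]
      simp only [hv', hi, if_true]
      rw [div_eq_iff (mul_ne_zero hne (abs_ne_zero.mpr hne))]
      exact hv i
    · simp [hΘ, hi, hv']
  · funext i
    by_cases hi : i ∈ A
    · simp [hi, hv']
    · simp [hi, hv0 i hi]

lemma cluster_between {X : Type*} [PseudoMetricSpace X] (u : ℕ → X) (p : X) {ε v : ℝ}
    (hinc : Tendsto (fun t => dist (u (t+1)) (u t)) atTop (𝓝 0))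
    (h1 : ∃ᶠ t in atTop, dist (u t) p < v) (h2 : ∃ᶠ t in atTop, ε ≤ dist (u t) p)
    (hv : v < ε) {η : ℝ} (hη : 0 < η) :
    ∃ᶠ t in atTop, |dist (u t) p - v| ≤ η := by
  rw [frequently_atTop]
  intro T
  have hev : ∀ᶠ t in atTop, dist (u (t+1)) (u t) < η := hinc.eventually (gt_mem_nhds hη)
  obtain ⟨T1, hT1⟩ := eventually_atTop.mp hev
  obtain ⟨t1, ht1, hd1⟩ := frequently_atTop.mp h1 (max T T1)
  obtain ⟨t2, ht2, hd2⟩ := frequently_atTop.mp h2 t1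
  classical
  have hex : ∃ m, v ≤ dist (u (t1 + m)) p := ⟨t2 - t1, by
    rw [Nat.add_sub_cancel' ht2]; linarith⟩
  set m := Nat.find hex with hm
  have hmspec : v ≤ dist (u (t1 + m)) p := Nat.find_spec hex
  have hm0 : m ≠ 0 := by
    intro h0
    rw [h0] at hmspec
    simp at hmspec; linarith
  obtain ⟨k, hk⟩ := Nat.exists_eq_succ_of_ne_zero hm0
  have hklt : dist (u (t1 + k)) p < v := by
    have := Nat.find_min hex (m := k) (by omega)
    linarith [not_le.mp this]
  have hst : dist (u (t1 + k + 1)) (u (t1 + k)) < η := hT1 _ (by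
    have := le_max_right T T1; omega)
  refine ⟨t1 + m, by have := le_max_left T T1; omega, ?_⟩
  have htri := dist_triangle (u (t1 + k + 1)) (u (t1 + k)) p
  have heq : t1 + m = t1 + k + 1 := by omega
  rw [heq] at hmspec ⊢
  rw [abs_le]; constructor <;> linarith

lemma converge_of_countable {X : Type*} [MetricSpace X] (u : ℕ → X) (K S : Set X)
    (hK : IsCompact K) (hu : ∀ t, u t ∈ K)
    (hinc : Tendsto (fun t => dist (u (t+1)) (u t)) atTop (𝓝 0))
    (hS : S.Countable)
    (hcl : ∀ (p : X) (φ : ℕ → ℕ), StrictMono φ → Tendsto (u ∘ φ) atTop (𝓝 p) → p ∈ S) :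
    ∃ r, Tendsto u atTop (𝓝 r) := by
  obtain ⟨p, hpK, φ, hφ, hp⟩ := hK.tendsto_subseq hu
  refine ⟨p, ?_⟩
  by_contra hnot
  rw [Metric.tendsto_nhds] at hnot
  push Not at hnot
  obtain ⟨ε, hε, hfreq⟩ := hnot
  have hsub : Set.Ioo 0 ε ⊆ (fun x => dist x p) '' S := by
    intro v hv
    have h1 : ∃ᶠ t in atTop, dist (u t) p < v := by
      have hh : ∀ᶠ n in atTop, dist (u (φ n)) p < v :=
        (tendsto_iff_dist_tendsto_zero.mp hp).eventually (gt_mem_nhds hv.1)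
      exact hφ.tendsto_atTop.frequently hh.frequently
    have h2 := fun n : ℕ => cluster_between u p hinc h1 hfreq hv.2
      (η := 1 / ((n : ℝ) + 1)) (by positivity)
    obtain ⟨ψ, hψ, hψ2⟩ := extraction_forall_of_frequently h2
    obtain ⟨q, hqK, χ, hχ, hq⟩ := hK.tendsto_subseq (fun n => hu (ψ n))
    refine ⟨q, hcl q (ψ ∘ χ) (hψ.comp hχ) hq, ?_⟩
    have t1 : Tendsto (fun n => dist (u (ψ (χ n))) p) atTop (𝓝 (dist q p)) :=
      (hq.dist tendsto_const_nhds)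
    have t2 : Tendsto (fun n => dist (u (ψ n)) p) atTop (𝓝 v) := by
      rw [tendsto_iff_dist_tendsto_zero]
      refine squeeze_zero (fun _ => dist_nonneg) (fun n => ?_) tendsto_one_div_add_atTop_nhds_zero_nat
      rw [Real.dist_eq]; exact hψ2 n
    exact tendsto_nhds_unique t1 (t2.comp hχ.tendsto_atTop)
  have hcount : (Set.Ioo 0 ε).Countable := (hS.image _).mono hsub
  have := hcount.measure_zero volume
  simp at this
  linarith

lemma abs_cube_convex (a b : ℝ) : |a|^3 + 3 * (a * |a|) * (b - a) ≤ |b|^3 := by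
  rcases abs_cases a with ⟨ha, ha'⟩ | ⟨ha, ha'⟩ <;> rcases abs_cases b with ⟨hb, hb'⟩ | ⟨hb, hb'⟩ <;>
    rw [ha, hb]
  · nlinarith [mul_nonneg (sq_nonneg (b - a)) ha', mul_nonneg (sq_nonneg (b - a)) hb']
  · nlinarith [mul_nonneg ha' (sq_nonneg a), pow_pos (neg_pos.mpr hb') 3, mul_nonneg (mul_nonneg ha' ha') (neg_pos.mpr hb').le]
  · have := neg_pos.mpr ha'
    nlinarith [pow_pos this 3, pow_nonneg hb' 3, mul_nonneg (sq_nonneg a) hb']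
  · nlinarith [mul_nonneg (sq_nonneg (b - a)) (neg_pos.mpr ha').le, mul_nonneg (sq_nonneg (b - a)) (neg_pos.mpr hb').le]

/-- inner product with a sample -/
noncomputable def dotp {N : ℕ} (d x : Fin N → ℝ) : ℝ := ∑ k, d k * x k

/-- the empirical objective -/
noncomputable def empF (N L : ℕ) (ω : Fin L → Fin N → ℝ) (d : Fin N → ℝ) : ℝ :=
  (1 / (L : ℝ)) * ∑ i, |dotp d (ω i)| ^ 3

lemma empG_eq (N L : ℕ) (ω : Fin L → Fin N → ℝ) (d : Fin N → ℝ) (j : Fin N) :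
    empG N L ω d j = ((3 : ℝ) / L) * ∑ i, dotp d (ω i) * |dotp d (ω i)| * ω i j := rfl

lemma empG_inner (N L : ℕ) (ω : Fin L → Fin N → ℝ) (d e : Fin N → ℝ) :
    ∑ j, empG N L ω d j * e j
      = ((3 : ℝ) / L) * ∑ i, dotp d (ω i) * |dotp d (ω i)| * dotp e (ω i) := by
  simp only [empG_eq, mul_assoc, Finset.sum_mul]
  rw [← Finset.mul_sum, Finset.sum_comm]
  congr 1
  apply Finset.sum_congr rfl; intro i _
  rw [← mul_assoc]
  conv_rhs => rw [dotp.eq_1 e, Finset.mul_sum]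
  apply Finset.sum_congr rfl; intro j _
  ring

lemma empG_inner_self (N L : ℕ) (ω : Fin L → Fin N → ℝ) (d : Fin N → ℝ) :
    ∑ j, empG N L ω d j * d j = 3 * empF N L ω d := by
  rw [empG_inner, empF, Finset.mul_sum, Finset.mul_sum, Finset.mul_sum]
  apply Finset.sum_congr rfl; intro i _
  have : |dotp d (ω i)|^3 = dotp d (ω i) * |dotp d (ω i)| * dotp d (ω i) := by
    rw [pow_succ, sq_abs]; ring
  rw [this]; ring

lemma empF_convex (N L : ℕ) (ω : Fin L → Fin N → ℝ) (d e : Fin N → ℝ) :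
    empF N L ω d + ∑ j, empG N L ω d j * (e j - d j) ≤ empF N L ω e := by
  have h1 : ∑ j, empG N L ω d j * (e j - d j) = ((3 : ℝ) / L) * ∑ i, dotp d (ω i) * |dotp d (ω i)| * (dotp e (ω i) - dotp d (ω i)) := by
    simp only [mul_sub, Finset.sum_sub_distrib]
    rw [empG_inner, empG_inner]
  rw [h1, empF, empF]
  have : ((3 : ℝ) / L) = (1 / (L:ℝ)) * 3 := by ring
  rw [this, mul_assoc, ← mul_add]
  apply mul_le_mul_of_nonneg_left _ (by positivity)
  rw [Finset.mul_sum, ← Finset.sum_add_distrib]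
  apply Finset.sum_le_sum
  intro i _
  have := abs_cube_convex (dotp d (ω i)) (dotp e (ω i))
  linarith

lemma empG_continuous (N L : ℕ) (ω : Fin L → Fin N → ℝ) (j : Fin N) :
    Continuous fun d => empG N L ω d j := by
  unfold empG; fun_prop

lemma empF_continuous (N L : ℕ) (ω : Fin L → Fin N → ℝ) :
    Continuous fun d => empF N L ω d := by
  unfold empF dotp; fun_prop

lemma gpmStep_continuousAt (N L : ℕ) (ω : Fin L → Fin N → ℝ) (p : Fin N → ℝ)
    (hp : ∑ k, empG N L ω p k ^ 2 ≠ 0) : ContinuousAt (gpmStep N L ω) p := by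
  unfold gpmStep
  rw [continuousAt_pi]
  intro j
  have h : Continuous fun d => ∑ k, empG N L ω d k ^ 2 :=
    continuous_finsetSum _ fun k _ => (empG_continuous N L ω k).pow 2
  refine (empG_continuous N L ω j).continuousAt.div (h.sqrt).continuousAt ?_
  have : 0 ≤ ∑ k, empG N L ω p k ^ 2 := Finset.sum_nonneg fun k _ => sq_nonneg _
  exact (Real.sqrt_pos.mpr (lt_of_le_of_ne this (Ne.symm hp))).ne'

lemma gpmStep_unit (N L : ℕ) (ω : Fin L → Fin N → ℝ) (p : Fin N → ℝ)
    (hp : ∑ k, empG N L ω p k ^ 2 ≠ 0) : ∑ k, gpmStep N L ω p k ^ 2 = 1 := by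
  unfold gpmStep
  have h0 : 0 ≤ ∑ k, empG N L ω p k ^ 2 := Finset.sum_nonneg fun k _ => sq_nonneg _
  simp only [div_pow, Real.sq_sqrt h0]
  rw [← Finset.sum_div, div_self hp]

lemma gpmStep_mul (N L : ℕ) (ω : Fin L → Fin N → ℝ) (p : Fin N → ℝ)
    (hp : ∑ k, empG N L ω p k ^ 2 ≠ 0) (j : Fin N) :
    empG N L ω p j = Real.sqrt (∑ k, empG N L ω p k ^ 2) * gpmStep N L ω p j := by
  have h0 : 0 ≤ ∑ k, empG N L ω p k ^ 2 := Finset.sum_nonneg fun k _ => sq_nonneg _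
  have := (Real.sqrt_pos.mpr (lt_of_le_of_ne h0 (Ne.symm hp))).ne'
  unfold gpmStep
  field_simp

lemma gpmIter_succ (N L : ℕ) (ω : Fin L → Fin N → ℝ) (d : Fin N → ℝ) (t : ℕ) :
    gpmIter N L ω d (t+1) = gpmStep N L ω (gpmIter N L ω d t) :=
  Function.iterate_succ_apply' _ _ _

lemma gpmStep_increase (N L : ℕ) (ω : Fin L → Fin N → ℝ) (d : Fin N → ℝ)
    (hd : ∑ k, d k ^ 2 = 1) (hg : ∑ k, empG N L ω d k ^ 2 ≠ 0) :
    empF N L ω d + Real.sqrt (∑ k, empG N L ω d k ^ 2) / 2 * ∑ k, (gpmStep N L ω d k - d k)^2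
      ≤ empF N L ω (gpmStep N L ω d) ∧
    3 * empF N L ω d ≤ Real.sqrt (∑ k, empG N L ω d k ^ 2) := by
  have h1 := gpmStep_unit N L ω d hg
  set e := gpmStep N L ω d with he
  set r := Real.sqrt (∑ k, empG N L ω d k ^ 2) with hr
  have h2 : ∀ j, empG N L ω d j = r * e j := gpmStep_mul N L ω d hg
  have h3 := empF_convex N L ω d e
  have h4 : ∑ k, (e k - d k)^2 = 2 - 2 * ∑ k, e k * d k := by
    have : ∀ k, (e k - d k)^2 = e k ^2 + d k ^ 2 - 2 * (e k * d k) := fun k => by ring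
    simp only [this, Finset.sum_sub_distrib, Finset.sum_add_distrib, h1, hd, ← Finset.mul_sum]
    norm_num
  have h5 : ∑ j, empG N L ω d j * (e j - d j) = r * (1 - ∑ k, e k * d k) := by
    have : ∀ j, empG N L ω d j * (e j - d j) = r * (e j ^2 - e j * d j) := fun j => by
      rw [h2]; ring
    simp only [this, ← Finset.mul_sum, Finset.sum_sub_distrib, h1]
  have h6 := empG_inner_self N L ω d
  have h7 : ∑ j, empG N L ω d j * d j = r * ∑ k, e k * d k := by
    rw [Finset.mul_sum]; apply Finset.sum_congr rfl; intro k _; rw [h2]; ring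
  have h8 : 0 ≤ ∑ k, (e k - d k)^2 := Finset.sum_nonneg fun k _ => sq_nonneg _
  have hr0 : 0 ≤ r := Real.sqrt_nonneg _
  constructor
  · rw [h4]; rw [h5] at h3; linarith
  · rw [← h6, h7]
    nlinarith

lemma empF_nonneg (N L : ℕ) (ω : Fin L → Fin N → ℝ) (d : Fin N → ℝ) : 0 ≤ empF N L ω d := by
  unfold empF; positivity

lemma empG_eq_zero_of_empF (N L : ℕ) (ω : Fin L → Fin N → ℝ) (d : Fin N → ℝ)
    (h : empF N L ω d = 0) (j : Fin N) : empG N L ω d j = 0 := by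
  rw [empG_eq]
  rcases Nat.eq_zero_or_pos L with h0 | h0
  · subst h0; simp
  unfold empF at h
  have hL : (0:ℝ) < L := by exact_mod_cast h0
  have h1 : ∑ i, |dotp d (ω i)| ^ 3 = 0 := by
    rcases mul_eq_zero.mp h with h | h
    · exact absurd h (by positivity)
    · exact h
  rw [Finset.sum_eq_zero_iff_of_nonneg (fun i _ => by positivity)] at h1
  have : ∀ i, dotp d (ω i) = 0 := fun i => by simpa using h1 i (Finset.mem_univ i)
  simp [this]

lemma sphere_compact (N : ℕ) : IsCompact {d : Fin N → ℝ | ∑ k, d k ^ 2 = 1} := by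
  apply Metric.isCompact_of_isClosed_isBounded
  · exact isClosed_eq (by fun_prop) continuous_const
  · refine (Metric.isBounded_closedBall (x := (0 : Fin N → ℝ)) (r := 1)).subset ?_
    intro d hd
    simp only [Set.mem_ofPred_eq] at hd
    rw [mem_closedBall_zero_iff, pi_norm_le_iff_of_nonneg zero_le_one]
    intro i
    rw [Real.norm_eq_abs, ← sq_le_one_iff_abs_le_one, ← hd]
    exact Finset.single_le_sum (f := fun k => d k ^ 2) (fun k _ => sq_nonneg _) (Finset.mem_univ i)

/-- The set of (positive-multiplier) critical directions. -/
def critSet {N L : ℕ} (ω : Fin L → Fin N → ℝ) : Set (Fin N → ℝ) :=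
  {p | ∑ k, p k ^ 2 = 1 ∧ ∃ μ > (0:ℝ), ∀ j, ∑ i, dotp p (ω i) * |dotp p (ω i)| * ω i j = μ * p j}

lemma gpm_zero_const (N L : ℕ) (ω : Fin L → Fin N → ℝ) (d : Fin N → ℝ) (t : ℕ)
    (h : ∑ k, empG N L ω (gpmIter N L ω d t) k ^ 2 = 0) :
    Tendsto (gpmIter N L ω d) atTop (𝓝 0) := by
  have h1 : gpmIter N L ω d (t+1) = 0 := by
    rw [gpmIter_succ]; funext j; simp [gpmStep, h]
  have h2 : gpmStep N L ω 0 = 0 := by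
    funext j; simp [gpmStep, empG]
  have h3 : ∀ s, gpmIter N L ω d (s + (t + 1)) = 0 := by
    intro s
    induction s with
    | zero => simpa using h1
    | succ s ih => rw [show s + 1 + (t+1) = (s + (t+1)) + 1 by ring, gpmIter_succ, ih, h2]
  rw [← tendsto_add_atTop_iff_nat (t+1)]
  simp only [h3]
  exact tendsto_const_nhds

lemma gpm_converges_aux (N L : ℕ) (ω : Fin L → Fin N → ℝ) (d₀ : Fin N → ℝ)
    (hd : ∑ k, d₀ k ^ 2 = 1) (hc : (critSet ω).Countable) (u : ℕ → Fin N → ℝ) (hu0 : u 0 = d₀)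
    (hsucc : ∀ t, u (t+1) = gpmStep N L ω (u t))
    (hz : ∀ t, ∑ k, empG N L ω (u t) k ^ 2 ≠ 0) :
    ∃ r, Tendsto u atTop (𝓝 r) ∧ ∑ k, r k ^ 2 = 1 := by
  have hunit : ∀ t, ∑ k, u t k ^ 2 = 1 := by
    intro t
    cases t with
    | zero => rw [hu0]; exact hd
    | succ t => rw [hsucc]; exact gpmStep_unit N L ω _ (hz t)
  have hF0 : 0 < empF N L ω d₀ := by
    refine lt_of_le_of_ne (empF_nonneg N L ω d₀) fun h => hz 0 ?_
    rw [hu0]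
    exact Finset.sum_eq_zero fun k _ => by rw [empG_eq_zero_of_empF N L ω d₀ h.symm]; simp
  have hstep := fun t => gpmStep_increase N L ω (u t) (hunit t) (hz t)
  simp only [← hsucc] at hstep
  have hmono : Monotone fun t => empF N L ω (u t) := by
    apply monotone_nat_of_le_succ
    intro t
    have h1 := (hstep t).1
    have : 0 ≤ Real.sqrt (∑ k, empG N L ω (u t) k ^ 2) / 2 * ∑ k, (u (t+1) k - u t k)^2 := by
      positivity
    linarith
  have hFge : ∀ t, empF N L ω d₀ ≤ empF N L ω (u t) := fun t => by
    have := hmono (Nat.zero_le t); simpa [hu0] using this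
  have hK := sphere_compact N
  obtain ⟨B, hB⟩ := (hK.image (empF_continuous N L ω)).bddAbove
  have hconv : ∃ l, Tendsto (fun t => empF N L ω (u t)) atTop (𝓝 l) := by
    refine ⟨_, tendsto_atTop_ciSup hmono ⟨B, ?_⟩⟩
    rintro _ ⟨t, rfl⟩
    exact hB ⟨u t, hunit t, rfl⟩
  obtain ⟨l, hl⟩ := hconv
  have hdiff : Tendsto (fun t => empF N L ω (u (t+1)) - empF N L ω (u t)) atTop (𝓝 0) := by
    have := ((tendsto_add_atTop_iff_nat 1).mpr hl).sub hl
    simpa using this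
  have hinc2 : ∀ t, dist (u (t+1)) (u t) ^ 2 ≤
      (2 / (3 * empF N L ω d₀)) * (empF N L ω (u (t+1)) - empF N L ω (u t)) := by
    intro t
    have h1 := (hstep t).1
    have h2 := (hstep t).2
    have h3 := hFge t
    have h4 : dist (u (t+1)) (u t) ^ 2 ≤ ∑ k, (u (t+1) k - u t k)^2 := by
      have h0 : 0 ≤ ∑ k, (u (t+1) k - u t k)^2 := Finset.sum_nonneg fun k _ => sq_nonneg _
      rw [← Real.le_sqrt dist_nonneg h0]
      rw [dist_pi_le_iff (Real.sqrt_nonneg _)]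
      intro k
      rw [Real.dist_eq]
      apply Real.abs_le_sqrt
      exact Finset.single_le_sum (f := fun k => (u (t+1) k - u t k)^2) (fun k _ => sq_nonneg _) (Finset.mem_univ k)
    have h5 : 0 ≤ ∑ k, (u (t+1) k - u t k)^2 := Finset.sum_nonneg fun k _ => sq_nonneg _
    rw [div_mul_eq_mul_div, le_div_iff₀ (by linarith)]
    nlinarith
  have hinc : Tendsto (fun t => dist (u (t+1)) (u t)) atTop (𝓝 0) := by
    have h1 : Tendsto (fun t => dist (u (t+1)) (u t) ^ 2) atTop (𝓝 0) := by
      refine squeeze_zero (fun t => sq_nonneg _) hinc2 ?_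
      simpa using hdiff.const_mul (2 / (3 * empF N L ω d₀))
    have h2 := h1.sqrt
    simpa [Real.sqrt_sq dist_nonneg] using h2
  have hcl : ∀ (p : Fin N → ℝ) (φ : ℕ → ℕ), StrictMono φ → Tendsto (u ∘ φ) atTop (𝓝 p) →
      p ∈ critSet ω := by
    intro p φ hφ hp
    have hpu : ∑ k, p k ^ 2 = 1 := by
      have := hK.isClosed.mem_of_tendsto hp (Eventually.of_forall fun n => hunit (φ n))
      exact this
    have hpF : empF N L ω d₀ ≤ empF N L ω p :=
      ge_of_tendsto' (((empF_continuous N L ω).tendsto p).comp hp) fun n => hFge (φ n)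
    have hpg : ∑ k, empG N L ω p k ^ 2 ≠ 0 := by
      intro h0
      have h1 := empG_inner_self N L ω p
      rw [Finset.sum_eq_zero_iff_of_nonneg (fun i _ => sq_nonneg _)] at h0
      have h2 : ∀ k, empG N L ω p k = 0 := fun k => by simpa using h0 k (Finset.mem_univ k)
      simp only [h2, zero_mul, Finset.sum_const_zero] at h1
      linarith
    have hstepc : Tendsto (fun n => u (φ n + 1)) atTop (𝓝 (gpmStep N L ω p)) := by
      simp only [hsucc]
      exact (gpmStep_continuousAt N L ω p hpg).tendsto.comp hp
    have hd0 : dist (gpmStep N L ω p) p = 0 := by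
      refine tendsto_nhds_unique (hstepc.dist hp) ?_
      exact hinc.comp hφ.tendsto_atTop
    have hfix : gpmStep N L ω p = p := dist_eq_zero.mp hd0
    have hL : (0:ℝ) < L := by
      rcases Nat.eq_zero_or_pos L with h | h
      · subst h; simp [empF] at hF0
      · exact_mod_cast h
    have hs : 0 < Real.sqrt (∑ k, empG N L ω p k ^ 2) :=
      Real.sqrt_pos.mpr (lt_of_le_of_ne (Finset.sum_nonneg fun k _ => sq_nonneg _) (Ne.symm hpg))
    refine ⟨hpu, (L/3) * Real.sqrt (∑ k, empG N L ω p k ^ 2), by positivity, fun j => ?_⟩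
    have h1 := gpmStep_mul N L ω p hpg j
    rw [hfix, empG_eq] at h1
    rw [mul_assoc, ← h1]
    field_simp
  obtain ⟨r, hr⟩ := converge_of_countable u _ _ hK hunit hinc hc hcl
  exact ⟨r, hr, hK.isClosed.mem_of_tendsto hr (Eventually.of_forall hunit)⟩

lemma gpm_converges (N L : ℕ) (ω : Fin L → Fin N → ℝ) (d₀ : Fin N → ℝ)
    (hd : ∑ k, d₀ k ^ 2 = 1) (hc : (critSet ω).Countable) :
    ∃ r, Tendsto (gpmIter N L ω d₀) atTop (𝓝 r) ∧ (r = 0 ∨ ∑ k, r k ^ 2 = 1) := by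
  by_cases hz : ∃ t, ∑ k, empG N L ω (gpmIter N L ω d₀ t) k ^ 2 = 0
  · obtain ⟨t, ht⟩ := hz
    exact ⟨0, gpm_zero_const N L ω d₀ t ht, Or.inl rfl⟩
  push Not at hz
  obtain ⟨r, h1, h2⟩ := gpm_converges_aux N L ω d₀ hd hc (gpmIter N L ω d₀) rfl
    (gpmIter_succ N L ω d₀) hz
  exact ⟨r, h1, Or.inr h2⟩

lemma critSet_countable_of_weights {N L : ℕ} (ω : Fin L → Fin N → ℝ) (w : Fin L → ℝ)
    (hw : ∀ i, 0 < w i)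
    (hc : {v : Fin L → ℝ | ∀ i, v i = w i * ((∑ k, (∑ j, ω i j * ω k j) * v k) *
      |∑ k, (∑ j, ω i j * ω k j) * v k|)}.Countable) :
    (critSet (fun i j => (w i) ^ ((1:ℝ)/3) * ω i j)).Countable := by
  refine (hc.image (fun v => fun j => (∑ i, v i * ω i j) /
    Real.sqrt (∑ j, (∑ i, v i * ω i j)^2))).mono ?_
  rintro p ⟨hp1, μ, hμ, hp⟩
  have hdot : ∀ i, dotp p (fun j => (w i) ^ ((1:ℝ)/3) * ω i j) =
      (w i) ^ ((1:ℝ)/3) * dotp p (ω i) := by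
    intro i; unfold dotp; rw [Finset.mul_sum]; apply Finset.sum_congr rfl; intro j _; ring
  have hcube : ∀ i, ((w i) ^ ((1:ℝ)/3)) ^ 3 = w i := by
    intro i
    rw [← Real.rpow_natCast, ← Real.rpow_mul (hw i).le]; norm_num
  have ht : ∀ i, 0 < (w i) ^ ((1:ℝ)/3) := fun i => Real.rpow_pos_of_pos (hw i) _
  have hp' : ∀ j, ∑ i, (w i * (dotp p (ω i) * |dotp p (ω i)|)) * ω i j = μ * p j := by
    intro j
    rw [← hp j]
    apply Finset.sum_congr rfl; intro i _
    simp only [hdot]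
    rw [abs_mul, abs_of_pos (ht i)]
    nth_rw 1 [← hcube i]
    ring
  have hμ0 := hμ.ne'
  set v : Fin L → ℝ := fun i => w i * (dotp p (ω i) * |dotp p (ω i)|) / μ^2 with hv
  have hv1 : ∀ j, ∑ i, v i * ω i j = p j / μ := by
    intro j
    have : ∑ i, v i * ω i j = (∑ i, (w i * (dotp p (ω i) * |dotp p (ω i)|)) * ω i j) / μ^2 := by
      rw [Finset.sum_div]; apply Finset.sum_congr rfl; intro i _; simp only [hv]; ring
    rw [this, hp' j]; field_simp
  refine ⟨v, ?_, ?_⟩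
  · intro i
    have hy : ∑ k, (∑ j, ω i j * ω k j) * v k = dotp p (ω i) / μ := by
      calc ∑ k, (∑ j, ω i j * ω k j) * v k = ∑ k, ∑ j, ω i j * (v k * ω k j) := by
            apply Finset.sum_congr rfl; intro k _; rw [Finset.sum_mul]
            apply Finset.sum_congr rfl; intro j _; ring
        _ = ∑ j, ω i j * ∑ k, v k * ω k j := by
            rw [Finset.sum_comm]; simp only [Finset.mul_sum]
        _ = dotp p (ω i) / μ := by
            simp only [hv1]; unfold dotp; rw [Finset.sum_div]
            apply Finset.sum_congr rfl; intro j _; ring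
    rw [hy, abs_div, abs_of_pos hμ]
    simp only [hv]; field_simp
  · funext j
    simp only [hv1]
    have : ∑ j, (p j / μ)^2 = (1/μ)^2 := by
      simp only [div_pow]; rw [← Finset.sum_div, hp1]; norm_num
    rw [this, Real.sqrt_sq (by positivity)]; field_simp

lemma pi_ac : ∀ (n : ℕ) {X : Type} [MeasurableSpace X] (μ ν : Fin n → Measure X)
    [∀ i, IsFiniteMeasure (μ i)] [∀ i, IsFiniteMeasure (ν i)],
    (∀ i, μ i ≪ ν i) → Measure.pi μ ≪ Measure.pi ν := by
  intro n
  induction n with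
  | zero =>
    intro X _ μ ν _ _ h
    rw [Measure.pi_of_empty μ, Measure.pi_of_empty ν]
  | succ n ih =>
    intro X _ μ ν _ _ h
    have e1 := (measurePreserving_piFinSuccAbove μ 0)
    have e2 := (measurePreserving_piFinSuccAbove ν 0)
    have h1 : (μ 0).prod (Measure.pi fun j => μ ((0 : Fin (n+1)).succAbove j)) ≪
        (ν 0).prod (Measure.pi fun j => ν ((0 : Fin (n+1)).succAbove j)) :=
      (h 0).prod (ih _ _ fun i => h _)
    rw [← e1.map_eq, ← e2.map_eq] at h1
    have h2 := h1.map (MeasurableEquiv.piFinSuccAbove (fun _ : Fin (n+1) => X) 0).symm.measurable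
    rwa [MeasurableEquiv.map_symm_map, MeasurableEquiv.map_symm_map] at h2

lemma gauss_scale (t : ℝ) (ht : t ≠ 0) : ∃ v : NNReal, v ≠ 0 ∧
    (gaussianReal 0 1).map (fun x => t * x) = gaussianReal 0 v := by
  refine ⟨.mk (t^2) (sq_nonneg _) * 1, ?_, ?_⟩
  · rw [mul_one]; intro h
    have := congrArg NNReal.toReal h
    simp at this; exact ht this
  · rw [gaussianReal_map_const_mul]; simp

lemma bgMeasure_ac (θ t : ℝ) (ht : t ≠ 0) :
    bgMeasure θ ≪ (bgMeasure θ).map (fun x => t * x) := by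
  have hm : Measurable fun x : ℝ => t * x := by fun_prop
  obtain ⟨v, hv, hmapg⟩ := gauss_scale t ht
  have hmap : (bgMeasure θ).map (fun x => t * x) =
      (1 - θ).toNNReal • Measure.dirac 0 + θ.toNNReal • gaussianReal 0 v := by
    unfold bgMeasure
    rw [Measure.map_add _ _ hm]
    simp only [Measure.map_smul]
    rw [hmapg, Measure.map_dirac' hm]; simp
  rw [hmap]
  unfold bgMeasure
  have hg : gaussianReal 0 1 ≪ gaussianReal 0 v :=
    (gaussianReal_absolutelyContinuous 0 one_ne_zero).trans (gaussianReal_absolutelyContinuous' 0 hv)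
  exact Measure.AbsolutelyContinuous.add (Measure.AbsolutelyContinuous.rfl) (hg.smul _)

instance bgPi_finite (θ : ℝ) (N : ℕ) : IsFiniteMeasure (bgPi θ N) := by
  unfold bgPi; infer_instance

instance bgSamples_finite (θ : ℝ) (N L : ℕ) : IsFiniteMeasure (bgSamples θ N L) := by
  unfold bgSamples; infer_instance

lemma bgPi_ac (θ t : ℝ) (N : ℕ) (ht : t ≠ 0) :
    bgPi θ N ≪ (bgPi θ N).map (fun x j => t * x j) := by
  unfold bgPi
  rw [Measure.pi_map_pi (f := fun _ x => t * x) (fun i => by fun_prop)]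
  exact pi_ac N _ _ fun i => bgMeasure_ac θ t ht

lemma bgSamples_ac (θ : ℝ) (N L : ℕ) (t : Fin L → ℝ) (ht : ∀ i, t i ≠ 0) :
    bgSamples θ N L ≪ (bgSamples θ N L).map (fun ω i j => t i * ω i j) := by
  unfold bgSamples
  have hm : ∀ i, Measurable fun (x : Fin N → ℝ) j => t i * x j := fun i =>
    measurable_pi_lambda _ fun j => (measurable_pi_apply j).const_mul _
  rw [Measure.pi_map_pi (f := fun i (x : Fin N → ℝ) j => t i * x j) (fun i => (hm i).aemeasurable)]
  exact pi_ac L _ _ fun i => bgPi_ac θ (t i) N (ht i)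

lemma gpmIter_measurable (N L : ℕ) (d₀ : Fin N → ℝ) (t : ℕ) :
    Measurable fun ω : Fin L → Fin N → ℝ => gpmIter N L ω d₀ t := by
  induction t with
  | zero => exact measurable_const
  | succ t ih =>
    simp only [gpmIter_succ]
    have hg : ∀ j, Measurable fun ω => empG N L ω (gpmIter N L ω d₀ t) j := by
      intro j
      have h1 : ∀ k, Measurable fun ω : Fin L → Fin N → ℝ => gpmIter N L ω d₀ t k :=
        fun k => (measurable_pi_apply k).comp ih
      unfold empG; fun_prop
    refine measurable_pi_lambda _ fun j => ?_
    unfold gpmStep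
    exact (hg j).div (Finset.measurable_sum _ fun k _ => (hg k).pow_const 2).sqrt

lemma gpm_ae_converges (θ : ℝ) (N L : ℕ) (d₀ : Fin N → ℝ) (hd : ∑ k, d₀ k ^ 2 = 1) :
    bgSamples θ N L {ω | ∃ r, Tendsto (gpmIter N L ω d₀) atTop (𝓝 r)}ᶜ = 0 := by
  set E : Set (Fin L → Fin N → ℝ) := {ω | ∃ r, Tendsto (gpmIter N L ω d₀) atTop (𝓝 r)}ᶜ with hE
  have hEm : MeasurableSet E :=
    (measurableSet_exists_tendsto (gpmIter_measurable N L d₀)).compl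
  set sc : (Fin L → Fin N → ℝ) × (Fin L → ℝ) → (Fin L → Fin N → ℝ) :=
    fun q i j => (q.2 i) ^ ((1:ℝ)/3) * q.1 i j with hsc
  have hscm : Measurable sc := by
    refine measurable_pi_lambda _ fun i => measurable_pi_lambda _ fun j => ?_
    simp only [hsc]
    exact (((measurable_pi_apply i).comp measurable_snd).pow_const _).mul
      ((measurable_pi_apply j).comp ((measurable_pi_apply i).comp measurable_fst))
  set box : Set (Fin L → ℝ) := Set.pi Set.univ fun _ => Set.Ioo 1 2 with hbox
  have hboxm : MeasurableSet box := MeasurableSet.univ_pi fun _ => measurableSet_Ioo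
  set Bad : Set ((Fin L → Fin N → ℝ) × (Fin L → ℝ)) := sc ⁻¹' E ∩ (Prod.snd ⁻¹' box) with hBad
  have hBadm : MeasurableSet Bad := (hscm hEm).inter (measurable_snd hboxm)
  have hnull : ((bgSamples θ N L).prod (volume : Measure (Fin L → ℝ))) Bad = 0 := by
    rw [Measure.measure_prod_null hBadm]
    refine Eventually.of_forall fun ω => ?_
    have hae := weights_countable (fun i k => ∑ j, ω i j * ω k j)
    refine measure_mono_null ?_ (ae_iff.mp hae)
    rintro w ⟨hw1, hw2⟩ hcount
    apply hw1
    obtain ⟨r, hr, _⟩ := gpm_converges N L _ d₀ hd (critSet_countable_of_weights ω w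
      (fun i => lt_trans one_pos (hw2 i trivial).1) hcount)
    exact ⟨r, hr⟩
  have hswap : ((volume : Measure (Fin L → ℝ)).prod (bgSamples θ N L)) (Prod.swap ⁻¹' Bad) = 0 := by
    rw [← Measure.prod_swap, Measure.map_apply measurable_swap (measurable_swap hBadm)]
    exact hnull
  rw [Measure.measure_prod_null (measurable_swap hBadm)] at hswap
  have hboxv : volume box ≠ 0 := by
    rw [hbox, Real.volume_pi_Ioo]; simp
  obtain ⟨w, hwbox, hw⟩ : ∃ w ∈ box, bgSamples θ N L (Prod.mk w ⁻¹' (Prod.swap ⁻¹' Bad)) = 0 := by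
    by_contra hcon
    push Not at hcon
    apply hboxv
    refine measure_mono_null ?_ (ae_iff.mp hswap)
    intro w hw
    exact hcon w hw
  have hac := bgSamples_ac θ N L (fun i => (w i) ^ ((1:ℝ)/3))
    (fun i => (Real.rpow_pos_of_pos (lt_trans one_pos (hwbox i trivial).1) _).ne')
  apply hac
  rw [Measure.map_apply (by fun_prop) hEm]
  refine measure_mono_null ?_ hw
  intro ω hω
  exact ⟨hω, hwbox⟩

/-- abstract properties of the population map -/
structure PopProp (N : ℕ) (θ K : ℝ) (n : Fin N) (H : (Fin N → ℝ) → Fin N → ℝ) : Prop where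
  nonneg : ∀ d, ∑ k, d k ^ 2 = 1 → ∀ j, 0 ≤ H d j
  lower : ∀ d, ∑ k, d k ^ 2 = 1 → θ * |d n| ≤ H d n
  gap : ∀ d, ∑ k, d k ^ 2 = 1 → ∀ j ≠ n, d j ^ 2 ≤ d n ^ 2 →
    (2/5) * θ * (d n ^ 2 - d j ^ 2) ≤ H d n - H d j

lemma goodSet_max {N : ℕ} {ζ : ℝ} (hζ : 0 < ζ) {n : Fin N} {s : ℝ} {d : Fin N → ℝ}
    (h1 : ∑ i, d i ^ 2 = 1) (h2 : ∀ j ≠ n, (1 + ζ) * d j ^ 2 ≤ d n ^ 2) :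
    1 ≤ N * d n ^ 2 := by
  rw [← h1]
  have : ∀ j ∈ Finset.univ, d j ^ 2 ≤ d n ^ 2 := by
    intro j _
    by_cases hj : j = n
    · rw [hj]
    · have := h2 j hj; nlinarith [sq_nonneg (d j)]
  have h := Finset.sum_le_card_nsmul Finset.univ (fun j => d j ^ 2) (d n ^ 2) this
  simpa using h

lemma gap_kappa {ζ a b : ℝ} (hζ : 0 < ζ) (h : (1 + ζ) * b ≤ a) : a ≤ ((1 + ζ)/ζ) * (a - b) := by
  rw [div_mul_eq_mul_div, le_div_iff₀ hζ]; nlinarith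

set_option maxHeartbeats 2000000 in
lemma dyn_core {N L : ℕ} {ω : Fin L → Fin N → ℝ} {θ K ζ δ s : ℝ} {n : Fin N}
    {H : (Fin N → ℝ) → Fin N → ℝ} (hP : PopProp N θ K n H) (hθ : 0 < θ) (hK : 0 < K)
    (hζ : 0 < ζ) (hζ1 : ζ < 1) (hδ : 0 ≤ δ)
    (hs : s = 1 ∨ s = -1)
    (hδ2 : δ * ((1 + ζ)/ζ) * (N:ℝ)^2 ≤ K * θ / 10)
    (hG : ∀ d : Fin N → ℝ, ∑ k, d k ^ 2 = 1 → ∀ j, |empG N L ω d j - K * d j * H d j| ≤ δ)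
    {d : Fin N → ℝ} (hd : goodSet N ζ n s d) :
    0 < s * empG N L ω d n ∧ ∀ j ≠ n, (1 + ζ) * empG N L ω d j ^ 2 ≤ empG N L ω d n ^ 2 := by
  obtain ⟨h1, h2, h3⟩ := hd
  have hmax := goodSet_max (s := s) hζ h1 h3
  have hN : (1:ℝ) ≤ N := by exact_mod_cast (n.pos)
  have hκ : 2 ≤ (1 + ζ)/ζ := by rw [le_div_iff₀ hζ]; linarith
  set κ := (1 + ζ)/ζ with hκd
  have hdn1 : d n ^ 2 ≤ 1 := by
    rw [← h1]; exact Finset.single_le_sum (f := fun k => d k ^ 2) (fun k _ => sq_nonneg _) (Finset.mem_univ n)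
  set a := |d n| with ha
  have hasq : a ^ 2 = d n ^ 2 := sq_abs _
  have hsa : s * d n = a := by
    rcases hs with rfl | rfl
    · rw [ha, abs_of_pos (by linarith)]; ring
    · rw [ha, abs_of_neg (by linarith)]; ring
  have ha0 : 0 < a := by rw [← hsa]; exact h2
  have ha1 : a ≤ 1 := by nlinarith
  have hKθ : 0 < K * θ := mul_pos hK hθ
  have hN0 : (0:ℝ) < N := by linarith
  have hHn := hP.lower d h1
  have hGn := hG d h1 n
  have hsabs : |s| = 1 := by rcases hs with rfl | rfl <;> simp
  have hgn : K * a * H d n - δ ≤ s * empG N L ω d n := by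
    have e1 : |s * (empG N L ω d n - K * d n * H d n)| ≤ δ := by rw [abs_mul, hsabs, one_mul]; exact hGn
    have e2 := (abs_le.mp e1).1
    have e3 : s * (empG N L ω d n - K * d n * H d n) = s * empG N L ω d n - K * (s * d n) * H d n := by ring
    rw [e3, hsa] at e2; linarith
  -- δ κ ≤ Kθ a^4 / 10
  have hδκ : δ * κ ≤ K * θ / 10 * a ^ 4 := by
    have e1 : 1 ≤ (N:ℝ)^2 * a^4 := by
      have : (N:ℝ)^2 * a^4 = (N * a^2)^2 := by ring
      rw [this, hasq]; nlinarith
    have e2 : δ * κ * 1 ≤ δ * κ * ((N:ℝ)^2 * a^4) :=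
      mul_le_mul_of_nonneg_left e1 (by positivity)
    have e3 := mul_le_mul_of_nonneg_right hδ2 (by positivity : 0 ≤ a ^ 4)
    nlinarith
  have hδ1 : δ ≤ K * θ / 10 * a ^ 4 / 2 := by nlinarith
  have ha4 : a^4 ≤ a^3 := by nlinarith [pow_pos ha0 3]
  have ha3 : a^3 ≤ a^2 := by nlinarith [pow_pos ha0 2]
  have hsg : 0 < s * empG N L ω d n := by
    have e1 : K * a * (θ * a) ≤ K * a * H d n := mul_le_mul_of_nonneg_left hHn (by positivity)
    have e2 : K * θ * a^4 ≤ K * θ * a^2 := mul_le_mul_of_nonneg_left (by linarith) hKθ.le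
    have : 0 < K * θ * a^2 := by positivity
    nlinarith
  refine ⟨hsg, fun j hj => ?_⟩
  have hjn := h3 j hj
  have hjn' : d j ^ 2 ≤ d n ^ 2 := by nlinarith [sq_nonneg (d j)]
  have hgap := hP.gap d h1 j hj hjn'
  have hHj := hP.nonneg d h1 j
  have hkap := gap_kappa hζ hjn
  rw [← hκd] at hkap
  set q := Real.sqrt (1 + ζ) with hq
  have hq2 : q ^ 2 = 1 + ζ := Real.sq_sqrt (by linarith)
  have hq0 : 0 ≤ q := Real.sqrt_nonneg _
  have hq32 : q ≤ 3/2 := by nlinarith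
  have hqd : q * |d j| ≤ a := by
    have hh : (q * |d j|) ^ 2 ≤ a ^ 2 := by rw [mul_pow, hq2, sq_abs, hasq]; exact hjn
    exact (pow_le_pow_iff_left₀ (mul_nonneg hq0 (abs_nonneg _)) ha0.le two_ne_zero).mp hh
  have hGj : |empG N L ω d j| ≤ K * |d j| * H d j + δ := by
    have e1 := hG d h1 j
    have e2 : |empG N L ω d j| ≤ |empG N L ω d j - K * d j * H d j| + |K * d j * H d j| := by
      have := abs_add_le (empG N L ω d j - K * d j * H d j) (K * d j * H d j)
      simpa using this
    have e3 : |K * d j * H d j| = K * |d j| * H d j := by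
      rw [abs_mul, abs_mul, abs_of_pos hK, abs_of_nonneg hHj]
    linarith
  have hmain : q * |empG N L ω d j| ≤ s * empG N L ω d n := by
    have e1 : q * |empG N L ω d j| ≤ q * (K * |d j| * H d j + δ) := mul_le_mul_of_nonneg_left hGj hq0
    have e2 : q * |d j| * (K * H d j) ≤ a * (K * H d j) := mul_le_mul_of_nonneg_right hqd (by positivity)
    have e3 : K * a * ((2/5) * θ * (d n ^ 2 - d j ^ 2)) ≤ K * a * (H d n - H d j) :=
      mul_le_mul_of_nonneg_left hgap (by positivity)
    -- need (1+q) δ ≤ K a (2/5) θ (gap)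
    have e4 : δ * κ ≤ K * θ / 10 * a * (κ * (d n ^ 2 - d j ^ 2)) := by
      have : K * θ / 10 * a ^ 4 ≤ K * θ / 10 * a * (κ * (d n ^ 2 - d j ^ 2)) := by
        have h : a^3 ≤ κ * (d n ^ 2 - d j ^ 2) := by
          rw [← hasq] at hkap ⊢; linarith
        have := mul_le_mul_of_nonneg_left h (by positivity : 0 ≤ K * θ / 10 * a)
        nlinarith
      linarith
    have e5 : δ ≤ K * θ / 10 * a * (d n ^ 2 - d j ^ 2) := by
      have hκ0 : 0 < κ := by linarith
      have : δ * κ ≤ (K * θ / 10 * a * (d n ^ 2 - d j ^ 2)) * κ := by linarith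
      exact le_of_mul_le_mul_right this hκ0
    have e6 : q * δ ≤ 3/2 * δ := mul_le_mul_of_nonneg_right hq32 hδ
    nlinarith
  have := pow_le_pow_left₀ (by positivity) hmain 2
  rw [mul_pow, hq2, sq_abs, mul_pow] at this
  have hs2 : s^2 = 1 := by rcases hs with rfl | rfl <;> norm_num
  rw [hs2, one_mul] at this
  exact this

lemma dyn_step {N L : ℕ} {ω : Fin L → Fin N → ℝ} {θ K ζ δ s : ℝ} {n : Fin N}
    {H : (Fin N → ℝ) → Fin N → ℝ} (hP : PopProp N θ K n H) (hθ : 0 < θ) (hK : 0 < K)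
    (hζ : 0 < ζ) (hζ1 : ζ < 1) (hδ : 0 ≤ δ)
    (hs : s = 1 ∨ s = -1)
    (hδ2 : δ * ((1 + ζ)/ζ) * (N:ℝ)^2 ≤ K * θ / 10)
    (hG : ∀ d : Fin N → ℝ, ∑ k, d k ^ 2 = 1 → ∀ j, |empG N L ω d j - K * d j * H d j| ≤ δ)
    {d : Fin N → ℝ} (hd : goodSet N ζ n s d) :
    goodSet N ζ n s (gpmStep N L ω d) ∧ ∑ k, empG N L ω d k ^ 2 ≠ 0 := by
  obtain ⟨h1, h2⟩ := dyn_core hP hθ hK hζ hζ1 hδ hs hδ2 hG hd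
  have hne : empG N L ω d n ≠ 0 := by rintro h; rw [h] at h1; simp at h1
  have hpos : 0 < ∑ k, empG N L ω d k ^ 2 :=
    lt_of_lt_of_le (by positivity : 0 < empG N L ω d n ^ 2)
      (Finset.single_le_sum (f := fun k => empG N L ω d k ^ 2) (fun k _ => sq_nonneg _) (Finset.mem_univ n))
  have hsq := Real.sqrt_pos.mpr hpos
  refine ⟨⟨gpmStep_unit N L ω d hpos.ne', ?_, ?_⟩, hpos.ne'⟩
  · unfold gpmStep; rw [← mul_div_assoc]; exact div_pos h1 hsq
  · intro j hj
    unfold gpmStep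
    rw [div_pow, div_pow, ← mul_div_assoc]
    exact div_le_div_of_nonneg_right (h2 j hj) (by positivity)

set_option maxHeartbeats 2000000 in
lemma dyn_limit {N L : ℕ} {ω : Fin L → Fin N → ℝ} {θ K ζ δ s ε : ℝ} {n : Fin N}
    {H : (Fin N → ℝ) → Fin N → ℝ} (hP : PopProp N θ K n H) (hθ : 0 < θ) (hK : 0 < K)
    (hζ : 0 < ζ) (hζ1 : ζ < 1) (hδ : 0 ≤ δ) (hε : 0 < ε) (hε2 : ε ≤ 2)
    (hs : s = 1 ∨ s = -1)
    (hδ3 : δ * ((1 + ζ)/ζ) * (N:ℝ)^2 ≤ K * θ * ε / 20)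
    (hG : ∀ d : Fin N → ℝ, ∑ k, d k ^ 2 = 1 → ∀ j, |empG N L ω d j - K * d j * H d j| ≤ δ)
    {d₀ r : Fin N → ℝ} (hd : goodSet N ζ n s d₀)
    (hr : Tendsto (gpmIter N L ω d₀) atTop (𝓝 r)) :
    Real.sqrt (∑ j, (r j - s * (if j = n then 1 else 0)) ^ 2) ≤ ε := by
  have hKθ : 0 < K * θ := mul_pos hK hθ
  have hδ2 : δ * ((1 + ζ)/ζ) * (N:ℝ)^2 ≤ K * θ / 10 := by nlinarith
  have hN : (1:ℝ) ≤ N := by exact_mod_cast (n.pos)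
  have hgood : ∀ t, goodSet N ζ n s (gpmIter N L ω d₀ t) := by
    intro t
    induction t with
    | zero => exact hd
    | succ t ih =>
      rw [gpmIter_succ]
      exact (dyn_step hP hθ hK hζ hζ1 hδ hs hδ2 hG ih).1
  have hrc : ∀ j, Tendsto (fun t => gpmIter N L ω d₀ t j) atTop (𝓝 (r j)) :=
    fun j => ((continuous_apply j).tendsto r).comp hr
  have hr1 : ∑ k, r k ^ 2 = 1 :=
    (sphere_compact N).isClosed.mem_of_tendsto hr (Eventually.of_forall fun t => (hgood t).1)
  have hr3 : ∀ j ≠ n, (1 + ζ) * r j ^ 2 ≤ r n ^ 2 := fun j hj =>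
    le_of_tendsto_of_tendsto' (((hrc j).pow 2).const_mul _) ((hrc n).pow 2) fun t => (hgood t).2.2 j hj
  have hr2' : 0 ≤ s * r n := ge_of_tendsto' ((hrc n).const_mul s) fun t => (hgood t).2.1.le
  have hmax := goodSet_max (s := s) hζ hr1 hr3
  have hrn0 : r n ≠ 0 := by rintro h; rw [h] at hmax; norm_num at hmax
  have hs0 : s ≠ 0 := by rcases hs with rfl | rfl <;> norm_num
  have hr2 : 0 < s * r n := lt_of_le_of_ne hr2' (Ne.symm (mul_ne_zero hs0 hrn0))
  have hrg : goodSet N ζ n s r := ⟨hr1, hr2, hr3⟩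
  obtain ⟨-, hne⟩ := dyn_step hP hθ hK hζ hζ1 hδ hs hδ2 hG hrg
  have hfix : gpmStep N L ω r = r := by
    have t1 : Tendsto (fun t => gpmIter N L ω d₀ (t+1)) atTop (𝓝 (gpmStep N L ω r)) := by
      simp only [gpmIter_succ]
      exact (gpmStep_continuousAt N L ω r hne).tendsto.comp hr
    exact tendsto_nhds_unique t1 ((tendsto_add_atTop_iff_nat 1).mpr hr)
  have hmul := gpmStep_mul N L ω r hne
  rw [hfix] at hmul
  set R := Real.sqrt (∑ k, empG N L ω r k ^ 2) with hR
  set κ := (1 + ζ)/ζ with hκd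
  have hκ : 2 ≤ κ := by rw [hκd, le_div_iff₀ hζ]; linarith
  set a := |r n| with ha
  have hasq : a ^ 2 = r n ^ 2 := sq_abs _
  have ha0 : 0 < a := abs_pos.mpr hrn0
  have hR0 : 0 ≤ R := Real.sqrt_nonneg _
  have hgj : ∀ j, |empG N L ω r j| = R * |r j| := fun j => by
    rw [hmul j, abs_mul, abs_of_nonneg hR0]
  -- coordinates bound
  have hcoord : ∀ j ≠ n, N * |r j| ≤ ε / 4 := by
    intro j hj
    have hjn := hr3 j hj
    have hjn' : r j ^ 2 ≤ r n ^ 2 := by nlinarith [sq_nonneg (r j)]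
    have hgap := hP.gap r hr1 j hj hjn'
    have hkap := gap_kappa hζ hjn
    rw [← hκd] at hkap
    have hHj := hP.nonneg r hr1 j
    have hHn := hP.nonneg r hr1 n
    set b := |r j| with hb
    have hb0 : 0 ≤ b := abs_nonneg _
    have hba : b ≤ a := by
      exact sq_le_sq.mp hjn'
    have u1 : |empG N L ω r j| ≤ K * b * H r j + δ := by
      have e1 := hG r hr1 j
      have e2 := abs_add_le (empG N L ω r j - K * r j * H r j) (K * r j * H r j)
      have e3 : |K * r j * H r j| = K * b * H r j := by
        rw [abs_mul, abs_mul, abs_of_pos hK, abs_of_nonneg hHj]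
      simp only [sub_add_cancel] at e2
      linarith
    have u2 : K * a * H r n - δ ≤ |empG N L ω r n| := by
      have e1 := hG r hr1 n
      have e2 := abs_sub_abs_le_abs_sub (K * r n * H r n) (empG N L ω r n)
      have e3 : |K * r n * H r n| = K * a * H r n := by
        rw [abs_mul, abs_mul, abs_of_pos hK, abs_of_nonneg hHn]
      rw [abs_sub_comm] at e2
      linarith
    rw [hgj] at u1 u2
    -- b (K a Hn - δ) ≤ b R a = a (R b) ≤ a (K b Hj + δ)
    have e1 : b * (K * a * H r n - δ) ≤ b * (R * a) := mul_le_mul_of_nonneg_left u2 hb0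
    have e2 : a * (R * b) ≤ a * (K * b * H r j + δ) := mul_le_mul_of_nonneg_left u1 ha0.le
    have e3 : K * a * b * (H r n - H r j) ≤ 2 * δ * a := by nlinarith
    have e4 : K * b * (H r n - H r j) ≤ 2 * δ := by
      have : (K * b * (H r n - H r j)) * a ≤ (2 * δ) * a := by linarith
      exact le_of_mul_le_mul_right this ha0
    have e5 : K * b * ((2/5) * θ * (r n ^ 2 - r j ^ 2)) ≤ 2 * δ :=
      (mul_le_mul_of_nonneg_left hgap (by positivity)).trans e4
    have e6 : K * θ * b * (r n ^ 2) ≤ 5 * (δ * κ) := by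
      have h1 := mul_le_mul_of_nonneg_left hkap (by positivity : 0 ≤ K * θ * b)
      have h2 := mul_le_mul_of_nonneg_right e5 (by linarith : 0 ≤ κ)
      nlinarith
    have e7 : K * θ * b ≤ 5 * (δ * κ) * N := by
      have h1 := mul_le_mul_of_nonneg_left hmax (by positivity : 0 ≤ K * θ * b)
      have h2 := mul_le_mul_of_nonneg_right e6 (by linarith : (0:ℝ) ≤ N)
      nlinarith
    have e8 : K * θ * (N * b) ≤ K * θ * (ε / 4) := by
      have h2 := mul_le_mul_of_nonneg_right e7 (by linarith : (0:ℝ) ≤ N)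
      nlinarith
    exact le_of_mul_le_mul_left e8 hKθ
  have hsa : s * r n = a := by
    rcases hs with rfl | rfl
    · rw [ha, abs_of_pos (by linarith)]; ring
    · rw [ha, abs_of_neg (by linarith)]; ring
  have hs2 : s^2 = 1 := by rcases hs with rfl | rfl <;> norm_num
  have hsplit : ∑ j, (r j - s * (if j = n then 1 else 0)) ^ 2 = 2 - 2 * a := by
    have : ∀ j, (r j - s * (if j = n then 1 else 0)) ^ 2
        = r j ^ 2 + (if j = n then 1 - 2 * a else 0) := by
      intro j
      by_cases hj : j = n
      · subst hj; simp only [if_true]; rw [← hsa]; nlinarith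
      · simp [hj]
    simp only [this, Finset.sum_add_distrib, hr1, Finset.sum_ite_eq', Finset.mem_univ, if_true]
    ring
  have hrest : 1 - a ^ 2 ≤ N * (ε / 4 / N) ^ 2 := by
    have e1 : 1 - a^2 = ∑ j ∈ Finset.univ.erase n, r j ^ 2 := by
      have h0 := Finset.add_sum_erase Finset.univ (fun j => r j ^ 2) (Finset.mem_univ n)
      beta_reduce at h0
      linarith
    rw [e1]
    have hN0 : (0:ℝ) < N := by linarith
    have hb : ∀ j ∈ Finset.univ.erase n, r j ^ 2 ≤ (ε / 4 / N)^2 := by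
      intro j hj
      rw [← sq_abs]
      apply pow_le_pow_left₀ (abs_nonneg _)
      rw [le_div_iff₀ hN0, mul_comm]
      exact hcoord j (Finset.ne_of_mem_erase hj)
    refine (Finset.sum_le_card_nsmul _ _ _ hb).trans ?_
    rw [nsmul_eq_mul]
    apply mul_le_mul_of_nonneg_right _ (sq_nonneg _)
    have := Finset.card_le_univ (Finset.univ.erase n)
    simp only [Fintype.card_fin] at this
    exact_mod_cast this
  rw [hsplit]
  apply Real.sqrt_le_iff.mpr
  refine ⟨hε.le, ?_⟩
  have hN0 : (0:ℝ) < N := by linarith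
  have e1 : N * (ε / 4 / N) ^ 2 ≤ ε^2/16 := by
    have : N * (ε / 4 / N) ^ 2 = ε^2 / 16 / N := by field_simp; norm_num
    rw [this]; exact div_le_self (by positivity) hN
  have ha1 : a ≤ 1 := by
    have : r n ^ 2 ≤ 1 := by
      rw [← hr1]; exact Finset.single_le_sum (f := fun k => r k ^ 2) (fun k _ => sq_nonneg _) (Finset.mem_univ n)
    nlinarith
  nlinarith

lemma sumsq_pow_le {N : ℕ} (m : ℕ) (x : Fin N → ℝ) :
    (∑ k, x k ^ 2) ^ (m+1) ≤ (N:ℝ) ^ m * ∑ k, x k ^ (2*(m+1)) := by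
  have h1 := pow_sum_le_card_mul_sum_pow (s := (Finset.univ : Finset (Fin N)))
    (f := fun k => x k ^ 2) (fun k _ => sq_nonneg _) m
  simp only [Finset.card_univ, Fintype.card_fin, ← pow_mul] at h1
  exact h1

lemma sumsq_moment {N : ℕ} (ν : Measure ℝ) [IsProbabilityMeasure ν] (m : ℕ)
    (h : Integrable (fun x : ℝ => x ^ (2*(m+1))) ν) :
    Integrable (fun x : Fin N → ℝ => (∑ k, x k ^ 2) ^ (m+1)) (Measure.pi fun _ => ν) ∧
    ∫ x : Fin N → ℝ, (∑ k, x k ^ 2) ^ (m+1) ∂(Measure.pi fun _ => ν)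
      ≤ (N:ℝ)^(m+1) * ∫ x, x ^ (2*(m+1)) ∂ν := by
  have hmp : ∀ k : Fin N, MeasurePreserving (Function.eval k) (Measure.pi fun _ : Fin N => ν) ν :=
    fun k => measurePreserving_eval (fun _ => ν) k
  have hi : ∀ k : Fin N, Integrable (fun x : Fin N → ℝ => x k ^ (2*(m+1))) (Measure.pi fun _ => ν) :=
    fun k => (hmp k).integrable_comp_of_integrable (g := fun x : ℝ => x ^ (2*(m+1))) h
  have hv : ∀ k : Fin N, ∫ x : Fin N → ℝ, x k ^ (2*(m+1)) ∂(Measure.pi fun _ => ν)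
      = ∫ x, x ^ (2*(m+1)) ∂ν := by
    intro k
    have e := integral_map (μ := Measure.pi fun _ : Fin N => ν) (φ := Function.eval k)
      (f := fun x : ℝ => x ^ (2*(m+1))) (measurable_pi_apply k).aemeasurable
      (continuous_pow _).aestronglyMeasurable
    rw [(hmp k).map_eq] at e
    exact e.symm
  have hI : Integrable (fun x : Fin N → ℝ => (N:ℝ) ^ m * ∑ k, x k ^ (2*(m+1))) (Measure.pi fun _ => ν) :=
    (integrable_finsetSum _ fun k _ => hi k).const_mul _
  have hle : ∀ x : Fin N → ℝ, (∑ k, x k ^ 2) ^ (m+1) ≤ (N:ℝ) ^ m * ∑ k, x k ^ (2*(m+1)) :=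
    sumsq_pow_le m
  have hnn : ∀ x : Fin N → ℝ, 0 ≤ (∑ k, x k ^ 2) ^ (m+1) := fun x =>
    pow_nonneg (Finset.sum_nonneg fun k _ => sq_nonneg _) _
  have hI2 : Integrable (fun x : Fin N → ℝ => (∑ k, x k ^ 2) ^ (m+1)) (Measure.pi fun _ => ν) := by
    refine hI.mono' (Continuous.aestronglyMeasurable (by fun_prop)) (ae_of_all _ fun x => ?_)
    rw [Real.norm_of_nonneg (hnn x)]; exact hle x
  refine ⟨hI2, (integral_mono hI2 hI hle).trans ?_⟩
  rw [integral_const_mul, integral_finsetSum _ fun k _ => hi k]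
  simp only [hv, Finset.sum_const, Finset.card_univ, Fintype.card_fin, nsmul_eq_mul]
  rw [pow_succ, mul_assoc]

lemma gauss_pow_integrable (m : ℕ) : Integrable (fun x : ℝ => x ^ m) (gaussianReal 0 1) := by
  have h := (memLp_id_gaussianReal (μ := 0) (v := 1) (m : NNReal)).integrable_norm_pow'
  refine h.mono' (continuous_pow _).aestronglyMeasurable (ae_of_all _ fun x => ?_)
  simp

lemma gauss_abs_pow_integrable (m : ℕ) : Integrable (fun x : ℝ => |x| ^ m) (gaussianReal 0 1) := by
  have := (gauss_pow_integrable m).norm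
  simpa using this

lemma bg_prob {θ : ℝ} (h0 : 0 ≤ θ) (h1 : θ ≤ 1) : IsProbabilityMeasure (bgMeasure θ) := by
  constructor
  unfold bgMeasure
  simp only [Measure.add_apply, Measure.smul_apply, measure_univ]
  rw [ENNReal.smul_def, ENNReal.smul_def, smul_eq_mul, smul_eq_mul, mul_one, mul_one, ← ENNReal.coe_add,
    ← Real.toNNReal_add (by linarith) h0]
  simp

lemma bg_integrable {θ : ℝ} {f : ℝ → ℝ} (hf : Integrable f (gaussianReal 0 1)) :
    Integrable f (bgMeasure θ) := by
  unfold bgMeasure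
  exact (Integrable.smul_measure_nnreal (integrable_dirac (by simp))).add_measure hf.smul_measure_nnreal

lemma bg_integral {θ : ℝ} (h0 : 0 ≤ θ) (h1 : θ ≤ 1) {f : ℝ → ℝ} (hf : Integrable f (gaussianReal 0 1)) :
    ∫ x, f x ∂(bgMeasure θ) = (1-θ) * f 0 + θ * ∫ x, f x ∂(gaussianReal 0 1) := by
  unfold bgMeasure
  rw [integral_add_measure (Integrable.smul_measure_nnreal (integrable_dirac (by simp))) hf.smul_measure_nnreal,
    integral_smul_nnreal_measure, integral_smul_nnreal_measure, integral_dirac]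
  simp only [NNReal.smul_def, smul_eq_mul]
  rw [Real.coe_toNNReal _ h0, Real.coe_toNNReal _ (by linarith)]

lemma cs_dot {N : ℕ} (a x : Fin N → ℝ) : (dotp a x)^2 ≤ (∑ k, a k ^2) * ∑ k, x k ^ 2 := by
  unfold dotp; exact Finset.sum_mul_sq_le_sq_mul_sq _ _ _

lemma coord_le {N : ℕ} (x : Fin N → ℝ) (j : Fin N) : x j ^ 2 ≤ ∑ k, x k ^ 2 :=
  Finset.single_le_sum (f := fun k => x k ^ 2) (fun k _ => sq_nonneg _) (Finset.mem_univ j)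

/-- |φ(a·x) x_j| ≤ A (1+S²) -/
lemma phi_bound {N : ℕ} (a x : Fin N → ℝ) (j : Fin N) :
    |dotp a x * |dotp a x| * x j| ≤ (∑ k, a k ^ 2) * (1 + (∑ k, x k ^ 2)^2) := by
  have h1 := cs_dot a x
  have h2 := coord_le x j
  have hA : 0 ≤ ∑ k, a k ^ 2 := Finset.sum_nonneg fun k _ => sq_nonneg _
  have hS : 0 ≤ ∑ k, x k ^ 2 := Finset.sum_nonneg fun k _ => sq_nonneg _
  generalize (∑ k, a k ^ 2) = A at *
  generalize (∑ k, x k ^ 2) = S at *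
  generalize dotp a x = y at *
  generalize x j = z at *
  rw [abs_mul, abs_mul, abs_abs, ← sq, sq_abs]
  have h3 : |z| * S ≤ 1 + S^2 := by
    have : |z|^2 ≤ S := by rw [sq_abs]; exact h2
    have hz := abs_nonneg z
    have : |z| ≤ 1 + S := by nlinarith [sq_nonneg (|z| - 1)]
    by_cases hc : S ≤ 1
    · have : |z| ≤ 1 := by nlinarith
      nlinarith
    · push Not at hc
      have : |z| ≤ S := by nlinarith
      nlinarith
  calc y^2 * |z| ≤ A * S * |z| := mul_le_mul_of_nonneg_right h1 (abs_nonneg _)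
    _ = A * (|z| * S) := by ring
    _ ≤ _ := mul_le_mul_of_nonneg_left h3 hA

lemma dotp_continuous {N : ℕ} (a : Fin N → ℝ) : Continuous (dotp a) := by
  unfold dotp; fun_prop

lemma phi_integrable {N : ℕ} (ν : Measure ℝ) [IsProbabilityMeasure ν]
    (h : Integrable (fun x : ℝ => x ^ 4) ν) (a : Fin N → ℝ) (j : Fin N) :
    Integrable (fun x : Fin N → ℝ => dotp a x * |dotp a x| * x j) (Measure.pi fun _ => ν) := by
  have hI := (sumsq_moment (N := N) ν 1 h).1
  have hI2 := ((integrable_const (1:ℝ)).add hI).const_mul (∑ k, a k ^ 2)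
  refine hI2.mono' ?_ (ae_of_all _ fun x => ?_)
  · have := dotp_continuous a
    exact Continuous.aestronglyMeasurable (by fun_prop)
  · exact phi_bound a x j

noncomputable def K3 : ℝ := ∫ z, |z| ^ 3 ∂(gaussianReal 0 1)

lemma K3_pos : 0 < K3 := by
  unfold K3
  rw [integral_pos_iff_support_of_nonneg (fun z => by positivity) (gauss_abs_pow_integrable 3)]
  have hs : Function.support (fun z : ℝ => |z| ^ 3) = {0}ᶜ := by
    ext z; simp
  rw [hs]
  have : gaussianReal 0 1 ({0}ᶜ : Set ℝ) = 1 := by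
    rw [prob_compl_eq_one_iff (measurableSet_singleton 0)]
    have := nullSingletonClass_gaussianReal (μ := 0) (v := 1) one_ne_zero
    exact measure_singleton 0
  rw [this]; exact zero_lt_one

lemma gauss_dot_law {N : ℕ} (a : Fin N → ℝ) :
    (Measure.pi fun _ : Fin N => gaussianReal 0 1).map (dotp a)
      = (gaussianReal 0 1).map (fun z => Real.sqrt (∑ k, a k ^ 2) * z) := by
  have hm : Measurable (dotp a) := (dotp_continuous a).measurable
  have : IsProbabilityMeasure ((Measure.pi fun _ : Fin N => gaussianReal 0 1).map (dotp a)) :=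
    Measure.isProbabilityMeasure_map hm.aemeasurable
  have hA : 0 ≤ ∑ k, a k ^ 2 := Finset.sum_nonneg fun k _ => sq_nonneg _
  rw [gaussianReal_map_const_mul]
  apply Measure.ext_of_charFun
  ext t
  rw [charFun_gaussianReal, charFun_apply_real,
    integral_map hm.aemeasurable (Continuous.aestronglyMeasurable (by fun_prop))]
  have e1 : ∀ x : Fin N → ℝ, Complex.exp (t * (dotp a x : ℝ) * Complex.I)
      = ∏ k, Complex.exp (((t * a k : ℝ) : ℂ) * (x k : ℂ) * Complex.I) := by
    intro x
    rw [← Complex.exp_sum]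
    congr 1
    unfold dotp
    push_cast
    rw [Finset.mul_sum, Finset.sum_mul]
    exact Finset.sum_congr rfl fun k _ => by ring
  simp only [e1]
  rw [integral_fintype_prod_eq_prod (𝕜 := ℂ) (fun k (z : ℝ) => Complex.exp (((t * a k : ℝ) : ℂ) * (z : ℂ) * Complex.I))]
  have e2 : ∀ k, ∫ z : ℝ, Complex.exp (((t * a k : ℝ) : ℂ) * (z : ℂ) * Complex.I) ∂(gaussianReal 0 1)
      = Complex.exp (- ((t * a k)^2 / 2 : ℝ)) := by
    intro k
    rw [← charFun_apply_real, charFun_gaussianReal]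
    congr 1
    push_cast; simp
  simp only [e2]
  rw [← Complex.exp_sum]
  congr 1
  have hsq := Real.sq_sqrt hA
  push_cast
  simp only [NNReal.coe_mk, mul_one]
  have h3 : ((Real.sqrt (∑ k, a k ^ 2) : ℂ))^2 = ∑ k, (a k : ℂ)^2 := by
    rw [← Complex.ofReal_pow, hsq]; push_cast; rfl
  simp
  rw [h3, Finset.sum_mul, ← Finset.sum_div]
  congr 1
  exact Finset.sum_congr rfl fun k _ => by ring

lemma gauss_cube {N : ℕ} (a : Fin N → ℝ) :
    ∫ g : Fin N → ℝ, |dotp a g| ^ 3 ∂(Measure.pi fun _ => gaussianReal 0 1)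
      = K3 * (∑ k, a k ^ 2) ^ ((3:ℝ)/2) := by
  have hm : Measurable (dotp a) := (dotp_continuous a).measurable
  have h1 := integral_map (μ := Measure.pi fun _ : Fin N => gaussianReal 0 1) (φ := dotp a)
    (f := fun z : ℝ => |z|^3) hm.aemeasurable (Continuous.aestronglyMeasurable (by fun_prop))
  rw [← h1, gauss_dot_law, integral_map (by fun_prop) (Continuous.aestronglyMeasurable (by fun_prop))]
  have hA : 0 ≤ ∑ k, a k ^ 2 := Finset.sum_nonneg fun k _ => sq_nonneg _
  simp only [abs_mul, mul_pow]
  rw [integral_const_mul, abs_of_nonneg (Real.sqrt_nonneg _), mul_comm, K3]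
  congr 1
  rw [Real.sqrt_eq_rpow, ← Real.rpow_natCast, ← Real.rpow_mul hA]
  norm_num

lemma cube_integrable {N : ℕ} (a : Fin N → ℝ) :
    Integrable (fun g : Fin N → ℝ => |dotp a g| ^ 3) (Measure.pi fun _ => gaussianReal 0 1) := by
  have : ∀ g : Fin N → ℝ, |dotp a g| ^ 3 = ∑ j, a j * (dotp a g * |dotp a g| * g j) := by
    intro g
    have : ∑ j, a j * (dotp a g * |dotp a g| * g j) = dotp a g * |dotp a g| * ∑ j, a j * g j := by
      rw [Finset.mul_sum]; exact Finset.sum_congr rfl fun j _ => by ring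
    rw [this]
    change _ = dotp a g * |dotp a g| * dotp a g
    have := abs_mul_abs_self (dotp a g)
    calc |dotp a g|^3 = |dotp a g| * |dotp a g| * |dotp a g| := by ring
      _ = _ := by rw [this]; ring
  simp only [this]
  exact integrable_finsetSum _ fun j _ =>
    (phi_integrable _ (gauss_pow_integrable 4) a j).const_mul _

lemma gauss_phi {N : ℕ} (a : Fin N → ℝ) (j : Fin N) :
    ∫ g : Fin N → ℝ, dotp a g * |dotp a g| * g j ∂(Measure.pi fun _ => gaussianReal 0 1)
      = K3 * Real.sqrt (∑ k, a k ^ 2) * a j := by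
  set m := ∫ g : Fin N → ℝ, dotp a g * |dotp a g| * g j ∂(Measure.pi fun _ => gaussianReal 0 1) with hm
  let at' : ℝ → Fin N → ℝ := fun t k => a k + t * (if k = j then 1 else 0)
  have hdot : ∀ t (g : Fin N → ℝ), dotp (at' t) g = dotp a g + t * g j := by
    intro t g
    simp only [dotp, at', add_mul, Finset.sum_add_distrib]
    congr 1
    simp [mul_assoc]
  have hsum : ∀ t, ∑ k, at' t k ^ 2 = (∑ k, a k ^ 2) + (2 * a j * t + t^2) := by
    intro t
    have : ∀ k, at' t k ^ 2 = a k ^ 2 + (if k = j then 2 * a j * t + t^2 else 0) := by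
      intro k
      by_cases hk : k = j
      · subst hk; simp [at']; ring
      · simp [at', hk]
    simp [this, Finset.sum_add_distrib]
  let ψ : ℝ → ℝ := fun t => K3 * ((∑ k, a k ^ 2) + (2 * a j * t + t^2)) ^ ((3:ℝ)/2)
  have hψ : ∀ t, ψ t = ∫ g : Fin N → ℝ, |dotp (at' t) g| ^ 3 ∂(Measure.pi fun _ => gaussianReal 0 1) := by
    intro t; rw [gauss_cube, hsum]
  have hconv : ∀ t, ψ 0 + 3 * t * m ≤ ψ t := by
    intro t
    have h0 : at' 0 = a := by ext k; simp [at']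
    rw [hψ 0, hψ t, h0, hm, ← integral_const_mul, ← integral_add (cube_integrable a)
      ((phi_integrable _ (gauss_pow_integrable 4) a j).const_mul _)]
    apply integral_mono ((cube_integrable a).add
      ((phi_integrable _ (gauss_pow_integrable 4) a j).const_mul _)) (cube_integrable _)
    intro g
    have := abs_cube_convex (dotp a g) (dotp (at' t) g)
    simp only [Pi.add_apply, hdot] at this ⊢
    linarith
  have hd : HasDerivAt ψ (K3 * ((2 * a j) * (3/2) * (∑ k, a k ^ 2) ^ ((1:ℝ)/2))) 0 := by
    have h1 : HasDerivAt (fun t : ℝ => (∑ k, a k ^ 2) + (2 * a j * t + t^2)) (2 * a j) 0 := by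
      have := (((hasDerivAt_id (0:ℝ)).const_mul (2 * a j)).add ((hasDerivAt_id (0:ℝ)).pow 2)).const_add (∑ k, a k ^ 2)
      have e : (2 * a j * 1 + (2:ℕ) * id (0:ℝ) ^ (2-1) * 1) = 2 * a j := by simp
      rw [e] at this
      exact this
    have h2 := (h1.rpow_const (p := 3/2) (Or.inr (by norm_num))).const_mul K3
    have e : K3 * (2 * a j * (3 / 2) * (∑ k, a k ^ 2 + (2 * a j * 0 + 0 ^ 2)) ^ ((3:ℝ) / 2 - 1))
      = K3 * ((2 * a j) * (3/2) * (∑ k, a k ^ 2) ^ ((1:ℝ)/2)) := by norm_num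
    rw [e] at h2
    exact h2
  have hd2 : HasDerivAt (fun t => ψ t - 3 * m * t) (K3 * ((2 * a j) * (3/2) * (∑ k, a k ^ 2) ^ ((1:ℝ)/2)) - 3 * m) 0 := by
    have := hd.sub ((hasDerivAt_id (0:ℝ)).const_mul (3 * m))
    simpa using! this
  have hmin : IsLocalMin (fun t => ψ t - 3 * m * t) 0 := by
    apply Filter.Eventually.of_forall
    intro t
    have := hconv t
    simp only [mul_zero, sub_zero]
    linarith
  have := hmin.hasDerivAt_eq_zero hd2
  rw [Real.sqrt_eq_rpow]
  linarith

noncomputable def bern (θ : ℝ) : Measure Bool :=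
  (1 - θ).toNNReal • Measure.dirac false + θ.toNNReal • Measure.dirac true

lemma bern_prob {θ : ℝ} (h0 : 0 ≤ θ) (h1 : θ ≤ 1) : IsProbabilityMeasure (bern θ) := by
  constructor
  unfold bern
  simp only [Measure.add_apply, Measure.smul_apply, measure_univ]
  rw [ENNReal.smul_def, ENNReal.smul_def, smul_eq_mul, smul_eq_mul, mul_one, mul_one, ← ENNReal.coe_add,
    ← Real.toNNReal_add (by linarith) h0]
  simp

noncomputable def chi (b : Bool) : ℝ := if b then 1 else 0

lemma chi_sq (b : Bool) : chi b ^ 2 = chi b := by cases b <;> simp [chi]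
lemma chi_nonneg (b : Bool) : 0 ≤ chi b := by cases b <;> simp [chi]
lemma chi_le (b : Bool) : chi b ≤ 1 := by cases b <;> simp [chi]

lemma bern_chi {θ : ℝ} (h0 : 0 ≤ θ) : ∫ b, chi b ∂(bern θ) = θ := by
  unfold bern
  rw [integral_add_measure (Integrable.smul_measure_nnreal (integrable_dirac (by simp)))
     (Integrable.smul_measure_nnreal (integrable_dirac (by simp))),
    integral_smul_nnreal_measure, integral_smul_nnreal_measure, integral_dirac, integral_dirac]
  simp [chi, NNReal.smul_def, h0]

lemma bern_map {θ : ℝ} (h0 : 0 ≤ θ) (h1 : θ ≤ 1) :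
    ((bern θ).prod (gaussianReal 0 1)).map (fun p : Bool × ℝ => chi p.1 * p.2) = bgMeasure θ := by
  have hm : Measurable (fun p : Bool × ℝ => chi p.1 * p.2) :=
    ((Measurable.of_discrete (f := chi)).comp measurable_fst).mul measurable_snd
  ext s hs
  rw [Measure.map_apply hm hs, Measure.prod_apply (hm hs)]
  unfold bern bgMeasure
  rw [lintegral_add_measure, lintegral_smul_measure, lintegral_smul_measure, lintegral_dirac, lintegral_dirac]
  simp only [Measure.add_apply, Measure.smul_apply]
  congr 2
  · classical
    have : (Prod.mk false ⁻¹' ((fun p : Bool × ℝ => chi p.1 * p.2) ⁻¹' s)) = if (0:ℝ) ∈ s then Set.univ else ∅ := by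
      ext x
      by_cases h : (0:ℝ) ∈ s <;> simp [chi, h]
    rw [this, Measure.dirac_apply' _ hs]
    by_cases h : (0:ℝ) ∈ s <;> simp [h]
  · congr 1
    ext x; simp [chi]

lemma bgPi_rep {θ : ℝ} (h0 : 0 ≤ θ) (h1 : θ ≤ 1) (N : ℕ) :
    ((Measure.pi fun _ : Fin N => bern θ).prod (Measure.pi fun _ : Fin N => gaussianReal 0 1)).map
      (fun p : (Fin N → Bool) × (Fin N → ℝ) => fun k => chi (p.1 k) * p.2 k) = bgPi θ N := by
  have := bern_prob h0 h1
  have := bg_prob h0 h1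
  have hm : Measurable (fun p : Bool × ℝ => chi p.1 * p.2) :=
    ((Measurable.of_discrete (f := chi)).comp measurable_fst).mul measurable_snd
  have h2 := (measurePreserving_arrowProdEquivProdArrow Bool ℝ (Fin N) (fun _ => bern θ)
    (fun _ => gaussianReal 0 1)).map_eq
  rw [← h2, Measure.map_map _ (MeasurableEquiv.measurable _)]
  · have h3 := Measure.pi_map_pi (μ := fun _ : Fin N => (bern θ).prod (gaussianReal 0 1))
      (f := fun _ (p : Bool × ℝ) => chi p.1 * p.2) (fun _ => hm.aemeasurable)
    rw [bern_map h0 h1] at h3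
    rw [bgPi, ← h3]
    rfl
  · refine measurable_pi_lambda _ fun k => ?_
    exact ((Measurable.of_discrete (f := chi)).comp ((measurable_pi_apply k).comp measurable_fst)).mul
      ((measurable_pi_apply k).comp measurable_snd)

noncomputable def sig {N : ℕ} (d : Fin N → ℝ) (b : Fin N → Bool) : ℝ :=
  Real.sqrt (∑ k, (d k * chi (b k)) ^ 2)

noncomputable def popH (N : ℕ) (θ : ℝ) (d : Fin N → ℝ) (j : Fin N) : ℝ :=
  ∫ b, chi (b j) * sig d b ∂(Measure.pi fun _ : Fin N => bern θ)

lemma pop_formula {θ : ℝ} (h0 : 0 ≤ θ) (h1 : θ ≤ 1) {N : ℕ} (d : Fin N → ℝ) (j : Fin N) :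
    ∫ x, dotp d x * |dotp d x| * x j ∂(bgPi θ N) = K3 * d j * popH N θ d j := by
  have := bern_prob h0 h1
  have := bg_prob h0 h1
  have hM : Measurable (fun p : (Fin N → Bool) × (Fin N → ℝ) => fun k => chi (p.1 k) * p.2 k) := by
    refine measurable_pi_lambda _ fun k => ?_
    exact ((Measurable.of_discrete (f := chi)).comp ((measurable_pi_apply k).comp measurable_fst)).mul
      ((measurable_pi_apply k).comp measurable_snd)
  have hc : Continuous (fun x : Fin N → ℝ => dotp d x * |dotp d x| * x j) := by
    have := dotp_continuous d
    fun_prop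
  have hI : Integrable (fun x : Fin N → ℝ => dotp d x * |dotp d x| * x j) (bgPi θ N) :=
    phi_integrable _ (bg_integrable (gauss_pow_integrable 4)) d j
  rw [← bgPi_rep h0 h1] at hI ⊢
  have hI2 := (integrable_map_measure hc.aestronglyMeasurable hM.aemeasurable).mp hI
  rw [integral_map hM.aemeasurable hc.aestronglyMeasurable]
  have := integral_prod _ hI2
  simp only [Function.comp_def] at this
  rw [this, popH, ← integral_const_mul]
  refine integral_congr_ae (ae_of_all _ fun b => ?_)
  simp only
  have e1 : ∀ g : Fin N → ℝ, dotp d (fun k => chi (b k) * g k) = dotp (fun k => d k * chi (b k)) g := by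
    intro g; unfold dotp; exact Finset.sum_congr rfl fun k _ => by ring
  simp only [e1]
  have e2 : ∀ g : Fin N → ℝ, dotp (fun k => d k * chi (b k)) g * |dotp (fun k => d k * chi (b k)) g| * (chi (b j) * g j)
     = chi (b j) * (dotp (fun k => d k * chi (b k)) g * |dotp (fun k => d k * chi (b k)) g| * g j) := by
    intro g; ring
  simp only [e2]
  rw [integral_const_mul, gauss_phi]
  change chi (b j) * (K3 * sig d b * (d j * chi (b j))) = _
  have := chi_sq (b j)
  calc _ = K3 * d j * (chi (b j)^2 * sig d b) := by ring
    _ = _ := by rw [this]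

lemma sig_nonneg {N : ℕ} (d : Fin N → ℝ) (b : Fin N → Bool) : 0 ≤ sig d b := Real.sqrt_nonneg _

lemma sig_sq {N : ℕ} (d : Fin N → ℝ) (b : Fin N → Bool) : sig d b ^ 2 = ∑ k, d k ^ 2 * chi (b k) := by
  unfold sig
  rw [Real.sq_sqrt (Finset.sum_nonneg fun k _ => sq_nonneg _)]
  exact Finset.sum_congr rfl fun k _ => by rw [mul_pow, chi_sq]

lemma sig_le {N : ℕ} (d : Fin N → ℝ) (hd : ∑ k, d k ^ 2 = 1) (b : Fin N → Bool) : sig d b ≤ 1 := by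
  have h := sig_sq d b
  have : ∑ k, d k ^ 2 * chi (b k) ≤ 1 := by
    rw [← hd]
    exact Finset.sum_le_sum fun k _ => mul_le_of_le_one_right (sq_nonneg _) (chi_le _)
  nlinarith [sig_nonneg d b]

lemma int_eval {θ : ℝ} (h0 : 0 ≤ θ) (h1 : θ ≤ 1) {N : ℕ} (n : Fin N) :
    ∫ b, chi (b n) ∂(Measure.pi fun _ : Fin N => bern θ) = θ := by
  have := bern_prob h0 h1
  have e := integral_map (μ := Measure.pi fun _ : Fin N => bern θ) (φ := Function.eval n)
      (f := chi) (measurable_pi_apply n).aemeasurable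
      (Measurable.of_discrete (f := chi)).aestronglyMeasurable
  rw [(measurePreserving_eval (fun _ : Fin N => bern θ) n).map_eq, bern_chi h0] at e
  exact e.symm

lemma int_eval2 {θ : ℝ} (h0 : 0 ≤ θ) (h1 : θ ≤ 1) {N : ℕ} {n j : Fin N} (hj : j ≠ n) :
    ∫ b, chi (b n) * chi (b j) ∂(Measure.pi fun _ : Fin N => bern θ) = θ ^ 2 := by
  have := bern_prob h0 h1
  have h := integral_fintype_prod_eq_prod (𝕜 := ℝ) (μ := fun _ : Fin N => bern θ)
    (fun k (b : Bool) => if k = n then chi b else if k = j then chi b else 1)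
  have e : ∀ f : Fin N → ℝ, ∏ k, (if k = n then f k else if k = j then f k else 1) = f n * f j := by
    intro f
    rw [← Finset.mul_prod_erase _ _ (Finset.mem_univ n),
      ← Finset.mul_prod_erase _ _ (Finset.mem_erase.mpr ⟨hj, Finset.mem_univ j⟩)]
    simp only [if_true, hj, if_false]
    rw [Finset.prod_eq_one, mul_one]
    intro k hk
    simp only [Finset.mem_erase] at hk
    simp [hk.1, hk.2.1]
  have e2 : ∀ k, ∫ b, (if k = n then chi b else if k = j then chi b else 1) ∂(bern θ)
      = (if k = n then θ else if k = j then θ else 1) := by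
    intro k
    split_ifs
    · exact bern_chi h0
    · exact bern_chi h0
    · rw [integral_const, probReal_univ, one_smul]
  simp only [e2] at h
  rw [e (fun _ => θ)] at h
  have e3 : ∀ b : Fin N → Bool, ∏ k, (if k = n then chi (b k) else if k = j then chi (b k) else 1) = chi (b n) * chi (b j) :=
    fun b => e (fun k => chi (b k))
  simp only [e3] at h
  rw [h]; ring

lemma half_gap {σ σ' D : ℝ} (s1 : σ ≤ 1) (s2 : σ' ≤ 1) (s3 : 0 ≤ σ) (s4 : 0 ≤ σ') (hD : 0 ≤ D)
    (hs : σ ^ 2 - σ' ^ 2 = D) : D / 2 ≤ σ - σ' := by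
  have : σ' ≤ σ := (pow_le_pow_iff_left₀ s4 s3 two_ne_zero).mp (by linarith)
  nlinarith

lemma popProp {θ : ℝ} (h0 : 0 ≤ θ) (h1 : θ ≤ 1/5) {N : ℕ} (K : ℝ) (n : Fin N) :
    PopProp N θ K n (popH N θ) := by
  have h1' : θ ≤ 1 := by linarith
  have := bern_prob h0 h1'
  constructor
  · intro d hd j
    exact integral_nonneg fun b => mul_nonneg (chi_nonneg _) (sig_nonneg _ _)
  · intro d hd
    have e : θ * |d n| = ∫ b, chi (b n) * |d n| ∂(Measure.pi fun _ : Fin N => bern θ) := by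
      rw [integral_mul_const, int_eval h0 h1']
    rw [e]
    apply integral_mono Integrable.of_finite Integrable.of_finite
    intro b
    simp only
    cases hb : b n
    · simp [chi]
    · simp only [chi, if_true, one_mul]
      apply abs_le_of_sq_le_sq _ (sig_nonneg d b) |> fun h => h
      rw [sig_sq]
      have := Finset.single_le_sum (f := fun k => d k ^ 2 * chi (b k))
        (fun k _ => mul_nonneg (sq_nonneg _) (chi_nonneg _)) (Finset.mem_univ n)
      simpa [hb, chi] using this
  · intro d hd j hj hdj
    let P := Measure.pi fun _ : Fin N => bern θ
    let e : Equiv.Perm (Fin N) := Equiv.swap n j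
    let T : (Fin N → Bool) → (Fin N → Bool) := fun b k => b (e k)
    have hT : MeasurePreserving T P P := by
      have := measurePreserving_piCongrLeft (fun _ : Fin N => bern θ) e
      have hh : (MeasurableEquiv.piCongrLeft (fun _ : Fin N => Bool) e : (Fin N → Bool) → (Fin N → Bool)) = T := by
        ext b k
        have := Equiv.piCongrLeft_apply_apply (fun _ : Fin N => Bool) e b (e k)
        simp only [e, Equiv.swap_apply_self] at this
        simp only [MeasurableEquiv.coe_piCongrLeft, T]
        rw [show Equiv.piCongrLeft (fun _ : Fin N => Bool) e b k = b (Equiv.swap n j k) from this]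
      rw [hh] at this
      exact this
    have hinv : ∀ f : (Fin N → Bool) → ℝ, ∫ b, f (T b) ∂P = ∫ b, f b ∂P := by
      intro f
      have e := integral_map (μ := P) (φ := T) (f := f) hT.measurable.aemeasurable
        (Measurable.of_discrete (f := f)).aestronglyMeasurable
      rw [hT.map_eq] at e
      exact e.symm
    have e1 : popH N θ d n - popH N θ d j = ∫ b, (chi (b n) - chi (b j)) * sig d b ∂P := by
      unfold popH
      rw [← integral_sub Integrable.of_finite Integrable.of_finite]
      simp only [sub_mul]; rfl
    have e2 : ∫ b, (chi (b n) - chi (b j)) * sig d b ∂P = ∫ b, (chi (b j) - chi (b n)) * sig d (T b) ∂P := by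
      rw [← hinv]
      simp [T, e]
    have e3 : 2 * (popH N θ d n - popH N θ d j) = ∫ b, (chi (b n) - chi (b j)) * (sig d b - sig d (T b)) ∂P := by
      have : ∀ b, (chi (b n) - chi (b j)) * (sig d b - sig d (T b))
        = (chi (b n) - chi (b j)) * sig d b + (chi (b j) - chi (b n)) * sig d (T b) := fun b => by ring
      simp only [this]
      rw [integral_add Integrable.of_finite Integrable.of_finite, ← e2, e1]; ring
    have e4 : ∫ b, (d n ^ 2 - d j ^ 2)/2 * (chi (b n) + chi (b j) - 2 * (chi (b n) * chi (b j))) ∂P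
       = (d n ^ 2 - d j ^ 2)/2 * (2 * θ - 2 * θ^2) := by
      rw [integral_const_mul, integral_sub Integrable.of_finite Integrable.of_finite,
        integral_add Integrable.of_finite Integrable.of_finite, integral_const_mul, int_eval h0 h1' n,
        int_eval h0 h1' j, int_eval2 h0 h1' hj]; ring
    have e5 : ∫ b, (d n ^ 2 - d j ^ 2)/2 * (chi (b n) + chi (b j) - 2 * (chi (b n) * chi (b j))) ∂P
       ≤ ∫ b, (chi (b n) - chi (b j)) * (sig d b - sig d (T b)) ∂P := by
      apply integral_mono Integrable.of_finite Integrable.of_finite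
      intro b
      have hs : sig d b ^ 2 - sig d (T b) ^ 2 = (d n ^ 2 - d j ^ 2) * (chi (b n) - chi (b j)) := by
        rw [sig_sq, sig_sq, ← Finset.sum_sub_distrib,
          ← Finset.add_sum_erase _ _ (Finset.mem_univ n),
          ← Finset.add_sum_erase _ _ (Finset.mem_erase.mpr ⟨hj, Finset.mem_univ j⟩)]
        rw [Finset.sum_eq_zero]
        · simp [T, e]; ring
        · intro k hk
          simp only [Finset.mem_erase] at hk
          simp [T, e, Equiv.swap_apply_of_ne_of_ne hk.2.1 hk.1]
      have s1 := sig_le d hd b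
      have s2 := sig_le d hd (T b)
      have s3 := sig_nonneg d b
      have s4 := sig_nonneg d (T b)
      have q1 := chi_sq (b n)
      have q2 := chi_sq (b j)
      have hD : 0 ≤ d n ^ 2 - d j ^ 2 := by linarith
      simp only
      generalize sig d b = σ at *
      generalize sig d (T b) = σ' at *
      generalize d n ^ 2 - d j ^ 2 = D at *
      cases hbn : b n <;> cases hbj : b j <;> simp only [hbn, hbj, chi] at * <;> norm_num at *
      · exact half_gap s2 s1 s4 s3 hD (by linarith)
      · exact half_gap s1 s2 s3 s4 hD hs
    rw [e4, ← e3] at e5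
    have hD : 0 ≤ d n ^ 2 - d j ^ 2 := by linarith
    have : θ * (4/5) ≤ θ - θ^2 := by nlinarith
    nlinarith [mul_le_mul_of_nonneg_left this hD]

lemma chernoff {α : Type*} [MeasurableSpace α] (μ : Measure α) [IsProbabilityMeasure μ] {Z : α → ℝ}
    (hZ : Measurable Z) {B V lam δ : ℝ} (hB : ∀ x, |Z x| ≤ B) (hV : ∫ x, Z x ^ 2 ∂μ ≤ V)
    (hl : 0 ≤ lam) (hlB : 2 * B * lam ≤ 1) (hlV : lam * V ≤ δ / 2) (L : ℕ) :
    (Measure.pi fun _ : Fin L => μ).real {ω | L * δ ≤ ∑ i, (Z (ω i) - ∫ x, Z x ∂μ)}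
      ≤ Real.exp (- (lam * L * δ / 2)) := by
  have hZi : Integrable Z μ := (integrable_const B).mono' hZ.aestronglyMeasurable (ae_of_all _ hB)
  set m := ∫ x, Z x ∂μ with hm
  have hZ2 : Integrable (fun x => Z x ^ 2) μ := by
    refine (integrable_const (B^2)).mono' (hZ.pow_const 2).aestronglyMeasurable (ae_of_all _ fun x => ?_)
    rw [Real.norm_of_nonneg (sq_nonneg _), ← sq_abs]
    exact pow_le_pow_left₀ (abs_nonneg _) (hB x) 2
  have hmB : |m| ≤ B := by
    have := norm_integral_le_of_norm_le_const (μ := μ) (f := Z) (ae_of_all _ hB)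
    simpa using this
  have hW : ∀ x, |lam * (Z x - m)| ≤ 1 := by
    intro x
    rw [abs_mul, abs_of_nonneg hl]
    have : |Z x - m| ≤ 2 * B := (abs_sub _ _).trans (by linarith [hB x])
    nlinarith
  have hexp : ∀ x, Real.exp (lam * (Z x - m)) ≤ 1 + lam * (Z x - m) + lam^2 * (Z x - m)^2 := by
    intro x
    have := (abs_le.mp (Real.abs_exp_sub_one_sub_id_le (hW x))).2
    nlinarith
  have hWi : Integrable (fun x => Z x - m) μ := hZi.sub (integrable_const _)
  have hW2 : ∀ x, (Z x - m)^2 = Z x ^ 2 - 2 * m * Z x + m^2 := fun x => by ring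
  have hW2i : Integrable (fun x => (Z x - m)^2) μ := by
    simp only [hW2]
    exact (hZ2.sub (hZi.const_mul _)).add (integrable_const _)
  have hW2v : ∫ x, (Z x - m)^2 ∂μ ≤ V := by
    simp only [hW2]
    have i1 : Integrable (fun x => Z x ^ 2 - 2 * m * Z x) μ := hZ2.sub (hZi.const_mul _)
    rw [integral_add i1 (integrable_const _), integral_sub hZ2 (hZi.const_mul _),
      integral_const_mul, ← hm]
    simp
    nlinarith [sq_nonneg m]
  have hei : Integrable (fun x => Real.exp (lam * (Z x - m))) μ := by
    refine (integrable_const (Real.exp 1)).mono' ?_ (ae_of_all _ fun x => ?_)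
    · exact (((hZ.sub_const m).const_mul lam).exp).aestronglyMeasurable
    · rw [Real.norm_of_nonneg (Real.exp_pos _).le]
      exact Real.exp_le_exp.mpr ((le_abs_self _).trans (hW x))
  have hE : ∫ x, Real.exp (lam * (Z x - m)) ∂μ ≤ Real.exp (lam^2 * V) := by
    have h1 : ∫ x, Real.exp (lam * (Z x - m)) ∂μ ≤ ∫ x, (1 + lam * (Z x - m) + lam^2 * (Z x - m)^2) ∂μ :=
      integral_mono hei (((integrable_const _).add (hWi.const_mul _)).add (hW2i.const_mul _)) hexp
    have h2 : ∫ x, (1 + lam * (Z x - m) + lam^2 * (Z x - m)^2) ∂μ = 1 + lam^2 * ∫ x, (Z x - m)^2 ∂μ := by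
      have i1 : Integrable (fun x => 1 + lam * (Z x - m)) μ := (integrable_const _).add (hWi.const_mul _)
      rw [integral_add i1 (hW2i.const_mul _),
        integral_add (integrable_const _) (hWi.const_mul _), integral_const_mul, integral_const_mul,
        integral_sub hZi (integrable_const _)]
      simp [hm]
    have h3 := Real.add_one_le_exp (lam^2 * V)
    have h4 := mul_le_mul_of_nonneg_left hW2v (sq_nonneg lam)
    linarith
  let X : (Fin L → α) → ℝ := fun ω => ∑ i, (Z (ω i) - m)
  have hprod : ∀ ω : Fin L → α, Real.exp (lam * X ω) = ∏ i, Real.exp (lam * (Z (ω i) - m)) := by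
    intro ω
    rw [← Real.exp_sum, ← Finset.mul_sum]
  have hint : Integrable (fun ω => Real.exp (lam * X ω)) (Measure.pi fun _ : Fin L => μ) := by
    simp only [hprod]
    exact Integrable.fintype_prod (f := fun _ x => Real.exp (lam * (Z x - m))) fun _ => hei
  have hmgf : mgf X (Measure.pi fun _ : Fin L => μ) lam ≤ Real.exp (lam^2 * V) ^ L := by
    unfold mgf
    simp only [hprod]
    rw [integral_fintype_prod_eq_prod (𝕜 := ℝ) (fun _ x => Real.exp (lam * (Z x - m)))]
    rw [Finset.prod_const, Finset.card_univ, Fintype.card_fin]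
    exact pow_le_pow_left₀ (integral_nonneg fun x => (Real.exp_pos _).le) hE L
  have h := measure_ge_le_exp_mul_mgf (X := X) (μ := Measure.pi fun _ : Fin L => μ) (L * δ) hl hint
  refine h.trans ((mul_le_mul_of_nonneg_left hmgf (Real.exp_pos _).le).trans ?_)
  rw [← Real.exp_nat_mul, ← Real.exp_add]
  apply Real.exp_le_exp.mpr
  have hL : (0:ℝ) ≤ L := Nat.cast_nonneg L
  nlinarith [mul_le_mul_of_nonneg_left hlV (mul_nonneg hl hL)]

lemma chernoff_abs {α : Type*} [MeasurableSpace α] (μ : Measure α) [IsProbabilityMeasure μ] {Z : α → ℝ}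
    (hZ : Measurable Z) {B V lam δ : ℝ} (hB : ∀ x, |Z x| ≤ B) (hV : ∫ x, Z x ^ 2 ∂μ ≤ V)
    (hl : 0 ≤ lam) (hlB : 2 * B * lam ≤ 1) (hlV : lam * V ≤ δ / 2) (L : ℕ) :
    (Measure.pi fun _ : Fin L => μ).real {ω | L * δ ≤ |∑ i, (Z (ω i) - ∫ x, Z x ∂μ)|}
      ≤ 2 * Real.exp (- (lam * L * δ / 2)) := by
  have h1 := chernoff μ hZ hB hV hl hlB hlV L
  have h2 := chernoff μ (Z := fun x => - Z x) hZ.neg (fun x => by rw [abs_neg]; exact hB x)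
    (by simpa using hV) hl hlB hlV L
  have hsub : {ω : Fin L → α | L * δ ≤ |∑ i, (Z (ω i) - ∫ x, Z x ∂μ)|} ⊆
     {ω | L * δ ≤ ∑ i, (Z (ω i) - ∫ x, Z x ∂μ)} ∪ {ω | L * δ ≤ ∑ i, (- Z (ω i) - ∫ x, - Z x ∂μ)} := by
    intro ω hω
    simp only [Set.mem_ofPred_eq, Set.mem_union] at hω ⊢
    rcases le_abs.mp hω with h | h
    · exact Or.inl h
    · right
      rw [integral_neg, ← Finset.sum_neg_distrib] at *
      refine h.trans (le_of_eq (Finset.sum_congr rfl fun i _ => by ring))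
  have := (measureReal_mono (μ := Measure.pi fun _ : Fin L => μ) hsub).trans (measureReal_union_le _ _)
  linarith

lemma round_exists (M : ℕ) (hM : 0 < M) (t : ℝ) (ht : |t| ≤ 1) :
    ∃ z : ℤ, z ∈ Finset.Icc (-(M:ℤ)) M ∧ |(z:ℝ)/M - t| ≤ 1/M ∧ ((z:ℝ)/M)^2 ≤ t^2 := by
  have hM0 : (0:ℝ) < M := by exact_mod_cast hM
  have key : ∀ t : ℝ, 0 ≤ t → t ≤ 1 → ∃ z : ℤ, z ∈ Finset.Icc (-(M:ℤ)) M ∧ |(z:ℝ)/M - t| ≤ 1/M ∧ ((z:ℝ)/M)^2 ≤ t^2 := by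
    intro t h0 h1
    have a1 := Int.floor_le (t * M)
    have a2 := Int.lt_floor_add_one (t * M)
    have a3 : 0 ≤ ⌊t * M⌋ := Int.floor_nonneg.mpr (by positivity)
    have a4 : (⌊t * M⌋:ℝ) / M ≤ t := by rw [div_le_iff₀ hM0]; exact a1
    have a3' : (0:ℝ) ≤ ⌊t * M⌋ := by exact_mod_cast a3
    refine ⟨⌊t * M⌋, ?_, ?_, ?_⟩
    · rw [Finset.mem_Icc]
      refine ⟨by omega, ?_⟩
      have : (⌊t * M⌋:ℝ) ≤ M := by nlinarith
      exact_mod_cast this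
    · rw [abs_of_nonpos (by linarith)]
      have : t ≤ (⌊t * M⌋ + 1)/M := by rw [le_div_iff₀ hM0]; exact a2.le
      rw [add_div] at this; linarith
    · exact pow_le_pow_left₀ (by positivity) a4 2
  rcases le_total 0 t with h | h
  · exact key t h (by rwa [abs_of_nonneg h] at ht)
  · obtain ⟨z, h1, h2, h3⟩ := key (-t) (by linarith) (by rwa [abs_of_nonpos h] at ht)
    refine ⟨-z, ?_, ?_, ?_⟩
    · rw [Finset.mem_Icc] at h1 ⊢; omega
    · push_cast
      rw [← abs_neg]; convert h2 using 2; ring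
    · push_cast
      rw [neg_div, neg_sq]; rw [neg_sq] at h3; exact h3

/-- truncated summand -/
noncomputable def trZ {N : ℕ} (R : ℝ) (d : Fin N → ℝ) (j : Fin N) (x : Fin N → ℝ) : ℝ :=
  open Classical in if ∑ k, x k ^ 2 ≤ R ^ 2 then 3 * (dotp d x * |dotp d x| * x j) else 0

lemma trZ_measurable {N : ℕ} (R : ℝ) (d : Fin N → ℝ) (j : Fin N) : Measurable (trZ R d j) := by
  unfold trZ
  have := (dotp_continuous d)
  refine Measurable.ite ?_ (Continuous.measurable (by fun_prop)) measurable_const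
  exact measurableSet_le (Continuous.measurable (by fun_prop)) measurable_const

lemma dot_abs_le {N : ℕ} {R : ℝ} (hR : 0 ≤ R) {D : ℝ} (hD : 0 ≤ D) {a x : Fin N → ℝ} (ha : ∑ k, a k ^ 2 ≤ D^2)
    (hx : ∑ k, x k ^ 2 ≤ R^2) : |dotp a x| ≤ D * R := by
  have h1 := cs_dot a x
  have h2 : (∑ k, a k ^ 2) * ∑ k, x k ^ 2 ≤ D^2 * R^2 :=
    mul_le_mul ha hx (Finset.sum_nonneg fun k _ => sq_nonneg _) (by positivity)
  apply abs_le_of_sq_le_sq _ (by positivity)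
  rw [mul_pow]; exact h1.trans h2

lemma phi_le {N : ℕ} {R : ℝ} (hR : 0 ≤ R) {d x : Fin N → ℝ} (hd : ∑ k, d k ^ 2 ≤ 1)
    (hx : ∑ k, x k ^ 2 ≤ R^2) (j : Fin N) : |3 * (dotp d x * |dotp d x| * x j)| ≤ 3 * R^3 := by
  have h1 : |dotp d x| ≤ 1 * R := dot_abs_le hR zero_le_one (by simpa using hd) hx
  have h2 : |x j| ≤ R := abs_le_of_sq_le_sq ((coord_le x j).trans hx) hR
  rw [abs_mul, abs_mul, abs_mul, abs_abs, abs_of_pos (by norm_num : (0:ℝ) < 3)]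
  have := mul_le_mul (mul_le_mul h1 h1 (abs_nonneg _) (by linarith)) h2 (abs_nonneg _) (by positivity)
  nlinarith

lemma trZ_bound {N : ℕ} {R : ℝ} (hR : 0 ≤ R) {d : Fin N → ℝ} (hd : ∑ k, d k ^ 2 ≤ 1) (j : Fin N)
    (x : Fin N → ℝ) : |trZ R d j x| ≤ 3 * R ^ 3 := by
  unfold trZ
  split_ifs with h
  · exact phi_le hR hd h j
  · simp; positivity

lemma phi_lip (y y' : ℝ) {R : ℝ} (h1 : |y| ≤ R) (h2 : |y'| ≤ R) :
    |y * |y| - (y' * |y'|)| ≤ 2 * R * |y - y'| := by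
  have e : y * |y| - y' * |y'| = (y - y') * |y| + y' * (|y| - |y'|) := by ring
  rw [e]
  refine (abs_add_le _ _).trans ?_
  rw [abs_mul, abs_mul, abs_abs]
  have := abs_abs_sub_abs_le_abs_sub y y'
  nlinarith [mul_le_mul_of_nonneg_left h1 (abs_nonneg (y - y')), mul_le_mul h2 this (abs_nonneg _) ((abs_nonneg _).trans h2)]

lemma trZ_lip {N : ℕ} {R η : ℝ} (hR : 0 ≤ R) (hη : 0 ≤ η) {d d' : Fin N → ℝ} (hd : ∑ k, d k ^ 2 ≤ 1)
    (hd' : ∑ k, d' k ^ 2 ≤ 1) (hdd : ∑ k, (d k - d' k) ^ 2 ≤ η ^ 2) (j : Fin N)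
    (x : Fin N → ℝ) : |trZ R d j x - trZ R d' j x| ≤ 6 * R ^ 3 * η := by
  unfold trZ
  split_ifs with h
  · have h1 : |dotp d x| ≤ 1 * R := dot_abs_le hR zero_le_one (by simpa using hd) h
    have h1' : |dotp d' x| ≤ 1 * R := dot_abs_le hR zero_le_one (by simpa using hd') h
    have h2 : |x j| ≤ R := abs_le_of_sq_le_sq ((coord_le x j).trans h) hR
    have h3 : |dotp (fun k => d k - d' k) x| ≤ η * R := dot_abs_le hR hη hdd h
    have h4 : dotp (fun k => d k - d' k) x = dotp d x - dotp d' x := by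
      unfold dotp; rw [← Finset.sum_sub_distrib]; exact Finset.sum_congr rfl fun k _ => by ring
    rw [h4] at h3
    rw [one_mul] at h1 h1'
    have h5 := phi_lip _ _ h1 h1'
    have e : 3 * (dotp d x * |dotp d x| * x j) - 3 * (dotp d' x * |dotp d' x| * x j)
      = 3 * (dotp d x * |dotp d x| - dotp d' x * |dotp d' x|) * x j := by ring
    rw [e, abs_mul, abs_mul, abs_of_pos (by norm_num : (0:ℝ) < 3)]
    have h6 : |dotp d x * |dotp d x| - (dotp d' x * |dotp d' x|)| ≤ 2 * R * (η * R) :=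
      h5.trans (mul_le_mul_of_nonneg_left h3 (by positivity))
    have h7 := mul_le_mul h6 h2 (abs_nonneg _) (by positivity)
    nlinarith
  · simp; positivity

noncomputable def M6 : ℝ := ∫ z, z ^ 6 ∂(gaussianReal 0 1)
noncomputable def M80 : ℝ := ∫ z, z ^ 80 ∂(gaussianReal 0 1)

lemma M6_nonneg : 0 ≤ M6 := integral_nonneg fun z => by positivity
lemma M80_nonneg : 0 ≤ M80 := integral_nonneg fun z => by positivity

lemma bgPi_prob {θ : ℝ} (h0 : 0 ≤ θ) (h1 : θ ≤ 1) (N : ℕ) : IsProbabilityMeasure (bgPi θ N) := by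
  have := bg_prob h0 h1
  unfold bgPi; infer_instance

lemma bgSamples_prob {θ : ℝ} (h0 : 0 ≤ θ) (h1 : θ ≤ 1) (N L : ℕ) : IsProbabilityMeasure (bgSamples θ N L) := by
  have := bgPi_prob h0 h1 N
  unfold bgSamples; infer_instance

lemma gauss_dot6 {N : ℕ} (a : Fin N → ℝ) :
    ∫ g : Fin N → ℝ, (dotp a g) ^ 6 ∂(Measure.pi fun _ => gaussianReal 0 1)
      = (∑ k, a k ^ 2) ^ 3 * M6 := by
  have hm : Measurable (dotp a) := (dotp_continuous a).measurable
  have h1 := integral_map (μ := Measure.pi fun _ : Fin N => gaussianReal 0 1) (φ := dotp a)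
    (f := fun z : ℝ => z^6) hm.aemeasurable (Continuous.aestronglyMeasurable (by fun_prop))
  rw [← h1, gauss_dot_law, integral_map (by fun_prop) (Continuous.aestronglyMeasurable (by fun_prop))]
  have hA : 0 ≤ ∑ k, a k ^ 2 := Finset.sum_nonneg fun k _ => sq_nonneg _
  simp only [mul_pow]
  rw [integral_const_mul, M6]
  congr 1
  rw [show (6:ℕ) = 2 * 3 from rfl, pow_mul, Real.sq_sqrt hA]

lemma bg_dot6_int {θ : ℝ} (h0 : 0 ≤ θ) (h1 : θ ≤ 1) {N : ℕ} (d : Fin N → ℝ) :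
    Integrable (fun x => (dotp d x) ^ 6) (bgPi θ N) := by
  have := bg_prob h0 h1
  have hI := (sumsq_moment (N := N) (bgMeasure θ) 2 (bg_integrable (gauss_pow_integrable 6))).1
  refine (hI.const_mul ((∑ k, d k ^ 2)^3)).mono' (((dotp_continuous d).pow 6).aestronglyMeasurable)
    (ae_of_all _ fun x => ?_)
  rw [Real.norm_of_nonneg (by positivity), ← mul_pow, show (6:ℕ) = 2 * 3 from rfl, pow_mul]
  exact pow_le_pow_left₀ (sq_nonneg _) (cs_dot d x) 3

lemma bg_dot6 {θ : ℝ} (h0 : 0 ≤ θ) (h1 : θ ≤ 1) {N : ℕ} (d : Fin N → ℝ) (hd : ∑ k, d k ^ 2 ≤ 1) :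
    ∫ x, (dotp d x) ^ 6 ∂(bgPi θ N) ≤ M6 := by
  have := bern_prob h0 h1
  have := bg_prob h0 h1
  have hM : Measurable (fun p : (Fin N → Bool) × (Fin N → ℝ) => fun k => chi (p.1 k) * p.2 k) := by
    refine measurable_pi_lambda _ fun k => ?_
    exact ((Measurable.of_discrete (f := chi)).comp ((measurable_pi_apply k).comp measurable_fst)).mul
      ((measurable_pi_apply k).comp measurable_snd)
  have hc : Continuous (fun x : Fin N → ℝ => (dotp d x) ^ 6) := (dotp_continuous d).pow 6
  have hI := bg_dot6_int h0 h1 d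
  rw [← bgPi_rep h0 h1] at hI ⊢
  have hI2 := (integrable_map_measure hc.aestronglyMeasurable hM.aemeasurable).mp hI
  rw [integral_map hM.aemeasurable hc.aestronglyMeasurable]
  have := integral_prod _ hI2
  simp only [Function.comp_def] at this
  rw [this]
  have e1 : ∀ (b : Fin N → Bool) (g : Fin N → ℝ), dotp d (fun k => chi (b k) * g k) = dotp (fun k => d k * chi (b k)) g := by
    intro b g; unfold dotp; exact Finset.sum_congr rfl fun k _ => by ring
  simp only [e1, gauss_dot6]
  have e2 : ∀ b : Fin N → Bool, (∑ k, (d k * chi (b k)) ^ 2) ^ 3 * M6 ≤ M6 := by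
    intro b
    apply mul_le_of_le_one_left M6_nonneg
    apply pow_le_one₀ (Finset.sum_nonneg fun k _ => sq_nonneg _)
    refine le_trans (Finset.sum_le_sum fun k _ => ?_) hd
    rw [mul_pow, chi_sq]
    exact mul_le_of_le_one_right (sq_nonneg _) (chi_le _)
  refine (integral_mono Integrable.of_finite (integrable_const M6) e2).trans ?_
  simp

lemma trZ_var {θ : ℝ} (h0 : 0 ≤ θ) (h1 : θ ≤ 1) {N : ℕ} (R : ℝ) (d : Fin N → ℝ) (hd : ∑ k, d k ^ 2 ≤ 1)
    (j : Fin N) : ∫ x, trZ R d j x ^ 2 ∂(bgPi θ N) ≤ 9 * M6 := by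
  let e : Fin N → ℝ := fun k => if k = j then 1 else 0
  have he : ∀ x, dotp e x = x j := fun x => by simp [dotp, e]
  have he1 : ∑ k, e k ^ 2 ≤ 1 := by simp [e]
  have hb : ∀ x, trZ R d j x ^ 2 ≤ 3 * (2 * dotp d x ^ 6 + dotp e x ^ 6) := by
    intro x
    unfold trZ
    rw [he]
    split_ifs
    · have : (3 * (dotp d x * |dotp d x| * x j))^2 = 9 * ((dotp d x ^2)^2 * (x j)^2) := by
        have := sq_abs (dotp d x)
        calc _ = 9 * (dotp d x ^2 * |dotp d x|^2 * (x j)^2) := by ring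
          _ = _ := by rw [this]; ring
      rw [this]
      have p1 := sq_nonneg (dotp d x)
      have p2 := sq_nonneg (x j)
      have : 3 * ((dotp d x ^ 2)^2 * x j ^ 2) ≤ 2 * (dotp d x ^2)^3 + (x j ^ 2)^3 := by
        nlinarith [mul_nonneg (sq_nonneg (dotp d x ^ 2 - x j ^ 2)) (by linarith : 0 ≤ 2 * dotp d x ^ 2 + x j ^ 2)]
      nlinarith
    · rw [zero_pow two_ne_zero]; positivity
  have i1 := bg_dot6_int h0 h1 d
  have i2 := bg_dot6_int h0 h1 e
  have i3 : Integrable (fun x => 3 * (2 * dotp d x ^ 6 + dotp e x ^ 6)) (bgPi θ N) :=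
    ((i1.const_mul 2).add i2).const_mul 3
  have i4 : Integrable (fun x => trZ R d j x ^ 2) (bgPi θ N) := by
    refine i3.mono' ((trZ_measurable R d j).pow_const 2).aestronglyMeasurable (ae_of_all _ fun x => ?_)
    rw [Real.norm_of_nonneg (sq_nonneg _)]; exact hb x
  refine (integral_mono i4 i3 hb).trans ?_
  rw [integral_const_mul, integral_add (i1.const_mul 2) i2, integral_const_mul]
  linarith [bg_dot6 h0 h1 d hd, bg_dot6 h0 h1 e he1]

lemma bg_S40 {θ : ℝ} (h0 : 0 ≤ θ) (h1 : θ ≤ 1) (N : ℕ) :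
    Integrable (fun x : Fin N → ℝ => (∑ k, x k ^ 2) ^ 40) (bgPi θ N) ∧
    ∫ x : Fin N → ℝ, (∑ k, x k ^ 2) ^ 40 ∂(bgPi θ N) ≤ (N:ℝ)^40 * M80 := by
  have := bg_prob h0 h1
  have h := sumsq_moment (N := N) (bgMeasure θ) 39 (bg_integrable (gauss_pow_integrable 80))
  refine ⟨h.1, h.2.trans ?_⟩
  have := bg_integral h0 h1 (gauss_pow_integrable 80)
  simp only [Nat.reduceMul, Nat.reduceAdd]
  rw [this]
  apply mul_le_mul_of_nonneg_left _ (by positivity)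
  have := M80_nonneg
  rw [M80] at *
  nlinarith

lemma bg_tail {θ : ℝ} (h0 : 0 ≤ θ) (h1 : θ ≤ 1) (N : ℕ) {R : ℝ} (hR : 0 < R) :
    (bgPi θ N).real {x | R^2 < ∑ k, x k ^ 2} ≤ M80 * (N:ℝ)^40 / R^80 := by
  have := bgPi_prob h0 h1 N
  obtain ⟨hI, hE⟩ := bg_S40 h0 h1 N
  have hm := mul_meas_ge_le_integral_of_nonneg (μ := bgPi θ N) (f := fun x : Fin N → ℝ => (∑ k, x k ^ 2) ^ 40)
    (ae_of_all _ fun x => pow_nonneg (Finset.sum_nonneg fun k _ => sq_nonneg _) _) hI (R^80)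
  have hsub : {x : Fin N → ℝ | R^2 < ∑ k, x k ^ 2} ⊆ {x | R^80 ≤ (∑ k, x k ^ 2) ^ 40} := by
    intro x hx
    simp only [Set.mem_ofPred_eq] at hx ⊢
    rw [show (80:ℕ) = 2 * 40 from rfl, pow_mul]
    exact pow_le_pow_left₀ (sq_nonneg _) hx.le 40
  have hmono := measureReal_mono (μ := bgPi θ N) hsub
  rw [le_div_iff₀ (by positivity)]
  have := mul_le_mul_of_nonneg_left hmono (by positivity : 0 ≤ R^80)
  linarith

lemma trZ_bias {θ : ℝ} (h0 : 0 ≤ θ) (h1 : θ ≤ 1) {N : ℕ} {R : ℝ} (hR : 0 < R) (d : Fin N → ℝ)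
    (hd : ∑ k, d k ^ 2 ≤ 1) (j : Fin N) :
    |∫ x, trZ R d j x ∂(bgPi θ N) - 3 * K3 * d j * popH N θ d j| ≤ 3 * R^3 / R^80 * ((N:ℝ)^40 * M80) := by
  have := bgPi_prob h0 h1 N
  have := bg_prob h0 h1
  obtain ⟨hI, hE⟩ := bg_S40 h0 h1 N
  have iphi : Integrable (fun x : Fin N → ℝ => 3 * (dotp d x * |dotp d x| * x j)) (bgPi θ N) :=
    (phi_integrable _ (bg_integrable (gauss_pow_integrable 4)) d j).const_mul 3
  have iZ : Integrable (trZ R d j) (bgPi θ N) :=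
    (integrable_const (3 * R^3)).mono' (trZ_measurable R d j).aestronglyMeasurable
      (ae_of_all _ fun x => trZ_bound hR.le hd j x)
  have e : 3 * K3 * d j * popH N θ d j = ∫ x, 3 * (dotp d x * |dotp d x| * x j) ∂(bgPi θ N) := by
    rw [integral_const_mul, pop_formula h0 h1]; ring
  rw [e, ← integral_sub iZ iphi, ← Real.norm_eq_abs]
  refine (norm_integral_le_of_norm_le (hI.const_mul (3 * R^3 / R^80)) (ae_of_all _ fun x => ?_)).trans ?_
  · rw [Real.norm_eq_abs]
    have hS : 0 ≤ ∑ k, x k ^ 2 := Finset.sum_nonneg fun k _ => sq_nonneg _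
    unfold trZ
    split_ifs with h
    · simp; positivity
    · push Not at h
      rw [zero_sub, abs_neg]
      set s := Real.sqrt (∑ k, x k ^ 2) with hs
      have hs2 : s ^ 2 = ∑ k, x k ^ 2 := Real.sq_sqrt hS
      have hs0 : 0 ≤ s := Real.sqrt_nonneg _
      have hRs : R ≤ s := Real.le_sqrt_of_sq_le h.le
      have hp := phi_le hs0 hd hs2.ge j
      refine hp.trans ?_
      rw [← hs2, ← pow_mul, div_mul_eq_mul_div, le_div_iff₀ (by positivity)]
      have h77 := pow_le_pow_left₀ hR.le hRs 77
      have := mul_le_mul_of_nonneg_left h77 (by positivity : 0 ≤ 3 * s^3 * R^3)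
      calc 3 * s^3 * R^80 = 3 * s^3 * R^3 * R^77 := by ring
        _ ≤ 3 * s^3 * R^3 * s^77 := this
        _ = 3 * R^3 * s^(2*40) := by ring
  · rw [integral_const_mul]
    exact mul_le_mul_of_nonneg_left hE (by positivity)

noncomputable def gridPt {N : ℕ} (M : ℕ) (f : Fin N → ℤ) : Fin N → ℝ := fun k => (f k : ℝ) / M

open Classical in
noncomputable def gridSet (N M : ℕ) : Finset (Fin N → ℤ) :=
  (Fintype.piFinset fun _ : Fin N => Finset.Icc (-(M:ℤ)) M).filter fun f => ∑ k, gridPt M f k ^ 2 ≤ 1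

lemma gridSet_card (N M : ℕ) : (gridSet N M).card ≤ (2 * M + 1)^N := by
  unfold gridSet
  refine (Finset.card_filter_le _ _).trans ?_
  rw [Fintype.card_piFinset]
  simp only [Int.card_Icc, Finset.prod_const, Finset.card_univ, Fintype.card_fin]
  apply le_of_eq
  congr 1
  omega

lemma grid_approx {N M : ℕ} (hM : 0 < M) (d : Fin N → ℝ) (hd : ∑ k, d k ^ 2 = 1) :
    ∃ f ∈ gridSet N M, ∑ k, (d k - gridPt M f k) ^ 2 ≤ (Real.sqrt N / M) ^ 2 := by
  have h : ∀ k, |d k| ≤ 1 := by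
    intro k
    apply abs_le_of_sq_le_sq _ zero_le_one
    rw [one_pow, ← hd]; exact coord_le d k
  choose f hf1 hf2 hf3 using fun k => round_exists M hM (d k) (h k)
  refine ⟨f, ?_, ?_⟩
  · unfold gridSet
    rw [Finset.mem_filter, Fintype.mem_piFinset]
    refine ⟨hf1, ?_⟩
    rw [← hd]
    exact Finset.sum_le_sum fun k _ => hf3 k
  · have hb : ∀ k ∈ Finset.univ, (d k - gridPt M f k) ^ 2 ≤ (1/(M:ℝ))^2 := by
      intro k _
      rw [← sq_abs, abs_sub_comm]
      exact pow_le_pow_left₀ (abs_nonneg _) (hf2 k) 2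
    refine (Finset.sum_le_card_nsmul _ _ _ hb).trans ?_
    rw [Finset.card_univ, Fintype.card_fin, nsmul_eq_mul, div_pow, div_pow, Real.sq_sqrt (Nat.cast_nonneg N)]
    apply le_of_eq; ring

lemma conc {θ : ℝ} (h0 : 0 ≤ θ) (hθ1 : θ ≤ 1) {N L M : ℕ} (hM : 0 < M) (hL : 0 < L) {R δ lam : ℝ} (hR : 0 < R)
    (hlam : 0 ≤ lam)
    (h1 : 6 * R^3 * (Real.sqrt N / M) ≤ δ / 4)
    (h2 : 3 * R^3 / R^80 * ((N:ℝ)^40 * M80) ≤ δ / 4)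
    (h3 : 2 * (3 * R^3) * lam ≤ 1)
    (h4 : lam * (9 * M6) ≤ (δ / 4) / 2) :
    (bgSamples θ N L).real {ω | ¬ ∀ d : Fin N → ℝ, ∑ k, d k ^ 2 = 1 →
        ∀ j, |empG N L ω d j - (3 * K3) * d j * popH N θ d j| ≤ δ}
      ≤ L * (M80 * (N:ℝ)^40 / R^80) + N * (((2 * M + 1 : ℕ) : ℝ) ^ N * (2 * Real.exp (- (lam * L * (δ / 4) / 2)))) := by
  classical
  have hpr := bgPi_prob h0 hθ1 N
  have hpr2 := bgSamples_prob h0 hθ1 N L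
  have hL0 : (0:ℝ) < L := by exact_mod_cast hL
  let A : Fin L → Set (Fin L → Fin N → ℝ) := fun i => {ω | R^2 < ∑ k, ω i k ^ 2}
  let Bd : (Fin N → ℤ) → Fin N → Set (Fin L → Fin N → ℝ) := fun f j =>
    {ω | L * (δ/4) ≤ |∑ i, (trZ R (gridPt M f) j (ω i) - ∫ x, trZ R (gridPt M f) j x ∂(bgPi θ N))|}
  have hsub : {ω | ¬ ∀ d : Fin N → ℝ, ∑ k, d k ^ 2 = 1 →
        ∀ j, |empG N L ω d j - (3 * K3) * d j * popH N θ d j| ≤ δ}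
      ⊆ (⋃ i ∈ (Finset.univ : Finset (Fin L)), A i) ∪
        ⋃ j ∈ (Finset.univ : Finset (Fin N)), ⋃ f ∈ gridSet N M, Bd f j := by
    intro ω hω
    by_contra hc
    simp only [Set.mem_union, Set.mem_iUnion, not_or, not_exists, Finset.mem_univ] at hc
    obtain ⟨hA, hB⟩ := hc
    apply hω
    intro d hd j
    have hA' : ∀ i, ∑ k, ω i k ^ 2 ≤ R^2 := fun i => by
      have := hA i trivial
      simp only [A, Set.mem_ofPred_eq, not_lt] at this
      exact this
    obtain ⟨f, hf, hfd⟩ := grid_approx hM d hd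
    have hfn : ∑ k, gridPt M f k ^ 2 ≤ 1 := by
      unfold gridSet at hf; exact (Finset.mem_filter.mp hf).2
    have hB' := hB j trivial f hf
    simp only [Bd, Set.mem_ofPred_eq, not_le] at hB'
    have hη : 0 ≤ Real.sqrt N / M := by positivity
    have hlip : ∀ x, |trZ R d j x - trZ R (gridPt M f) j x| ≤ δ/4 := fun x =>
      (trZ_lip hR.le hη hd.le hfn hfd j x).trans h1
    -- empirical
    have hemp : empG N L ω d j = (∑ i, trZ R d j (ω i)) / L := by
      rw [empG_eq]
      have : ∀ i, trZ R d j (ω i) = 3 * (dotp d (ω i) * |dotp d (ω i)| * ω i j) := fun i => by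
        unfold trZ; rw [if_pos (hA' i)]
      simp only [this]
      rw [← Finset.mul_sum]; ring
    have s1 : |(∑ i, trZ R d j (ω i)) - ∑ i, trZ R (gridPt M f) j (ω i)| ≤ L * (δ/4) := by
      rw [← Finset.sum_sub_distrib]
      refine (Finset.abs_sum_le_sum_abs _ _).trans ?_
      refine (Finset.sum_le_card_nsmul _ _ _ fun i _ => hlip (ω i)).trans ?_
      simp
    have iZ : ∀ d' : Fin N → ℝ, ∑ k, d' k ^ 2 ≤ 1 → Integrable (trZ R d' j) (bgPi θ N) := fun d' hd' =>
      (integrable_const (3 * R^3)).mono' (trZ_measurable R d' j).aestronglyMeasurable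
        (ae_of_all _ fun x => trZ_bound hR.le hd' j x)
    have s2 : |∫ x, trZ R d j x ∂(bgPi θ N) - ∫ x, trZ R (gridPt M f) j x ∂(bgPi θ N)| ≤ δ/4 := by
      rw [← integral_sub (iZ d hd.le) (iZ _ hfn)]
      have := norm_integral_le_of_norm_le_const (μ := bgPi θ N)
        (f := fun x => trZ R d j x - trZ R (gridPt M f) j x) (ae_of_all _ hlip)
      simpa using this
    have s3 := (trZ_bias h0 hθ1 hR d hd.le j).trans h2
    have s4 : |(∑ i, trZ R (gridPt M f) j (ω i)) - L * ∫ x, trZ R (gridPt M f) j x ∂(bgPi θ N)| ≤ L * (δ/4) := by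
      rw [Finset.sum_sub_distrib] at hB'
      simp at hB'
      exact hB'.le
    rw [hemp]
    generalize (∑ i, trZ R d j (ω i)) = a1 at *
    generalize (∑ i, trZ R (gridPt M f) j (ω i)) = a2 at *
    generalize ∫ x, trZ R d j x ∂(bgPi θ N) = b1 at *
    generalize ∫ x, trZ R (gridPt M f) j x ∂(bgPi θ N) = b2 at *
    generalize 3 * K3 * d j * popH N θ d j = g at *
    have s5 : |a1 - L * g| ≤ L * δ := by
      have t2 : |L * b2 - L * b1| ≤ L * (δ/4) := by
        rw [← mul_sub, abs_mul, abs_of_pos hL0, abs_sub_comm]; exact mul_le_mul_of_nonneg_left s2 hL0.le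
      have t3 : |L * b1 - L * g| ≤ L * (δ/4) := by
        rw [← mul_sub, abs_mul, abs_of_pos hL0]; exact mul_le_mul_of_nonneg_left s3 hL0.le
      rw [abs_le] at *
      constructor <;> linarith [s1.1, s1.2, s4.1, s4.2, t2.1, t2.2, t3.1, t3.2]
    have : a1 / L - g = (a1 - L * g) / L := by field_simp
    rw [this, abs_div, abs_of_pos hL0, div_le_iff₀ hL0]
    linarith
  refine (measureReal_mono hsub).trans ((measureReal_union_le _ _).trans (add_le_add ?_ ?_))
  · refine (measureReal_biUnion_finset_le _ _).trans ?_
    have : ∀ i ∈ (Finset.univ : Finset (Fin L)), (bgSamples θ N L).real (A i) ≤ M80 * (N:ℝ)^40 / R^80 := by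
      intro i _
      have hms : MeasurableSet {x : Fin N → ℝ | R^2 < ∑ k, x k ^ 2} :=
        measurableSet_lt measurable_const (Continuous.measurable (by fun_prop))
      have hmp := (measurePreserving_eval (fun _ : Fin L => bgPi θ N) i).measureReal_preimage hms.nullMeasurableSet
      refine le_trans (le_of_eq ?_) (bg_tail h0 hθ1 N hR)
      rw [← hmp]; rfl
    refine (Finset.sum_le_card_nsmul _ _ _ this).trans ?_
    simp
  · refine (measureReal_biUnion_finset_le _ _).trans ?_
    have : ∀ j ∈ (Finset.univ : Finset (Fin N)), (bgSamples θ N L).real (⋃ f ∈ gridSet N M, Bd f j)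
        ≤ ((2 * M + 1 : ℕ) : ℝ) ^ N * (2 * Real.exp (- (lam * L * (δ / 4) / 2))) := by
      intro j _
      refine (measureReal_biUnion_finset_le _ _).trans ?_
      have hf : ∀ f ∈ gridSet N M, (bgSamples θ N L).real (Bd f j) ≤ 2 * Real.exp (- (lam * L * (δ / 4) / 2)) := by
        intro f hf
        have hfn : ∑ k, gridPt M f k ^ 2 ≤ 1 := by
          unfold gridSet at hf; exact (Finset.mem_filter.mp hf).2
        exact chernoff_abs (bgPi θ N) (trZ_measurable R (gridPt M f) j) (fun x => trZ_bound hR.le hfn j x)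
          (trZ_var h0 hθ1 R _ hfn j) hlam h3 h4 L
      refine (Finset.sum_le_card_nsmul _ _ _ hf).trans ?_
      rw [nsmul_eq_mul]
      apply mul_le_mul_of_nonneg_right _ (by positivity)
      exact_mod_cast gridSet_card N M
    refine (Finset.sum_le_card_nsmul _ _ _ this).trans ?_
    simp

lemma log_le_four {l : ℝ} (hl : 0 < l) {q : ℝ} (hq : 0 < q) (h : q ^ 4 = l) : Real.log l ≤ 4 * q := by
  rw [← h, Real.log_pow]
  have := Real.log_le_sub_one_of_pos hq
  push_cast; linarith

lemma num5b {D C u n l : ℝ} (hD : 0 ≤ D) (hC1 : 12 * D ≤ C) (hC2 : (4 * D)^4 ≤ C) (hC : 1 ≤ C) (hn : 1 ≤ n) (hnu : n ≤ u)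
    (hu : 1 ≤ Real.log u) (hl : C * u^2 * n^3 * Real.log u ≤ l) : D * u^2 * n^3 * Real.log l ≤ l := by
  have hu1 : 1 ≤ u := hn.trans hnu
  have hC0 : 0 ≤ C := by linarith
  have hP : 1 ≤ u^2 * n^3 := one_le_mul_of_one_le_of_one_le (one_le_pow₀ hu1) (one_le_pow₀ hn)
  have hP' : 1 ≤ u^2 * n^3 * Real.log u := one_le_mul_of_one_le_of_one_le hP hu
  have hlC : C ≤ l := by nlinarith
  have hl0 : 0 < l := by linarith
  by_cases hc : Real.log l ≤ 12 * Real.log u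
  · have : D * (u^2 * n^3) * Real.log l ≤ D * (u^2 * n^3) * (12 * Real.log u) :=
      mul_le_mul_of_nonneg_left hc (by positivity)
    have h2 : 12 * D * (u^2 * n^3 * Real.log u) ≤ C * (u^2 * n^3 * Real.log u) :=
      mul_le_mul_of_nonneg_right hC1 (by linarith)
    nlinarith
  · push Not at hc
    have hu0 : 0 < u := by linarith
    have h12 : u^12 ≤ l := by
      have : Real.log (u^12) < Real.log l := by rw [Real.log_pow]; push_cast; exact hc
      exact ((Real.log_lt_log_iff (by positivity) hl0).mp this).le
    set q := Real.sqrt (Real.sqrt l) with hq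
    have hq4 : q^4 = l := by
      rw [show (4:ℕ) = 2 * 2 from rfl, pow_mul, Real.sq_sqrt (Real.sqrt_nonneg _), Real.sq_sqrt hl0.le]
    have hq0 : 0 < q := Real.sqrt_pos.mpr (Real.sqrt_pos.mpr hl0)
    have hlog := log_le_four hl0 hq0 hq4
    have hq1 : 4 * D ≤ q := by
      have : (4 * D)^4 ≤ q^4 := by rw [hq4]; linarith
      exact (pow_le_pow_iff_left₀ (by positivity) hq0.le (by norm_num)).mp this
    have hq3 : u^3 ≤ q := by
      have : (u^3)^4 ≤ q^4 := by rw [hq4, ← pow_mul]; exact h12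
      exact (pow_le_pow_iff_left₀ (by positivity) hq0.le (by norm_num)).mp this
    have hn3 : n^3 ≤ u^3 := pow_le_pow_left₀ (by linarith) hnu 3
    have h23 : u^2 ≤ u^3 := pow_le_pow_right₀ hu1 (by norm_num)
    calc D * u^2 * n^3 * Real.log l ≤ D * u^2 * n^3 * (4 * q) := mul_le_mul_of_nonneg_left hlog (by positivity)
      _ = (4 * D) * u^2 * n^3 * q := by ring
      _ ≤ q * q * q * q := by gcongr <;> linarith
      _ = l := by rw [← hq4]; ring

lemma num36 {C' C u r τ : ℝ} (hC' : 1 ≤ C') (hC : C'^2 ≤ C) (hr : 1 ≤ r) (hnu : r^2 ≤ u) (hτ : 0 < τ)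
    (h : C * u^2 * (r^2)^3 ≤ τ^40) : C' * u * r^7 ≤ τ^36 := by
  have hu1 : 1 ≤ u := (one_le_pow₀ hr).trans hnu
  apply (pow_le_pow_iff_left₀ (by positivity) (by positivity) (by norm_num : 10 ≠ 0)).mp
  have hC1 : 1 ≤ C := (one_le_pow₀ hC').trans hC
  have h9 := pow_le_pow_left₀ (by positivity) h 9
  calc (C' * u * r^7)^10 = C'^10 * (u^10 * r^54 * (r^2)^8) := by ring
    _ ≤ C'^18 * (u^10 * r^54 * u^8) := by
        gcongr
        norm_num
    _ = (C'^2 * u^2 * (r^2)^3)^9 := by ring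
    _ ≤ (C * u^2 * (r^2)^3)^9 := by gcongr
    _ ≤ (τ^40)^9 := h9
    _ = (τ^36)^10 := by ring

/-- all numerical conditions -/
lemma numerics (c₁ V m : ℝ) (hc : 0 < c₁) (hV : 0 < V) (hm : 0 ≤ m) : ∃ C : ℝ, 100 ≤ C ∧
    ∀ (n l u r τ : ℝ), 1 ≤ r → r^2 = n → n ≤ u → 1 ≤ Real.log u → 0 < τ → τ^40 = l →
      C * u^2 * n^3 * Real.log u ≤ l →
      6 * (r*τ)^3 * (r / l^2) ≤ (c₁/(u*n)) / 4 ∧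
      3 * (r*τ)^3 / (r*τ)^80 * (n^40 * m) ≤ (c₁/(u*n)) / 4 ∧
      5 * n * Real.log l ≤ (min (1/(6*(r*τ)^3)) ((c₁/(u*n))/(8*V))) * l * ((c₁/(u*n))/4) / 2 := by
  refine ⟨100 + 24/c₁ + 12*m/c₁ + (9600/c₁ + 1)^2 + 12*(320*V/c₁^2) + (4*(320*V/c₁^2))^4, ?_, ?_⟩
  · have : 0 ≤ 24/c₁ + 12*m/c₁ + (9600/c₁ + 1)^2 + 12*(320*V/c₁^2) + (4*(320*V/c₁^2))^4 := by positivity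
    linarith
  intro n l u r τ hr hrn hnu hlog hτ hτl hl
  set C := 100 + 24/c₁ + 12*m/c₁ + (9600/c₁ + 1)^2 + 12*(320*V/c₁^2) + (4*(320*V/c₁^2))^4 with hCdef
  have p1 : 0 ≤ 24/c₁ := by positivity
  have p2 : 0 ≤ 12*m/c₁ := by positivity
  have p3 : 0 ≤ (9600/c₁ + 1)^2 := by positivity
  have p4 : 0 ≤ 12*(320*V/c₁^2) := by positivity
  have p5 : 0 ≤ (4*(320*V/c₁^2))^4 := by positivity
  have q0 : 100 ≤ C := by linarith
  have q1 : 24/c₁ ≤ C := by linarith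
  have q2 : 12*m/c₁ ≤ C := by linarith
  have q3 : (9600/c₁+1)^2 ≤ C := by linarith
  have q4 : 12*(320*V/c₁^2) ≤ C := by linarith
  have q5 : (4*(320*V/c₁^2))^4 ≤ C := by linarith
  clear_value C
  have q1' : 24 ≤ C * c₁ := by rwa [div_le_iff₀ hc] at q1
  have q2' : 12 * m ≤ C * c₁ := by rwa [div_le_iff₀ hc] at q2
  have hn1 : 1 ≤ n := by rw [← hrn]; exact one_le_pow₀ hr
  have hu1 : 1 ≤ u := hn1.trans hnu
  have hn0 : 0 < n := by linarith
  have hu0 : 0 < u := by linarith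
  have hr0 : 0 < r := by linarith
  have hC0 : 0 < C := by linarith
  have hl' : C * u^2 * n^3 ≤ l := by
    have : C * u^2 * n^3 * 1 ≤ C * u^2 * n^3 * Real.log u := mul_le_mul_of_nonneg_left hlog (by positivity)
    linarith
  have hl1 : 1 ≤ l := by
    have : 1 ≤ u^2 * n^3 := one_le_mul_of_one_le_of_one_le (one_le_pow₀ hu1) (one_le_pow₀ hn1)
    nlinarith
  have hl0 : 0 < l := by linarith
  have hτ1 : 1 ≤ τ := by
    by_contra hh
    push Not at hh
    have := pow_lt_one₀ hτ.le hh (by norm_num : 40 ≠ 0)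
    linarith
  have hrn3 : r^3 ≤ n^2 := by
    rw [← hrn, ← pow_mul]; exact pow_le_pow_right₀ hr (by norm_num)
  have huu : u ≤ u^2 := by nlinarith
  refine ⟨?_, ?_, ?_⟩
  · rw [div_div, mul_div_assoc', div_le_div_iff₀ (by positivity) (by positivity)]
    have hτ3 : τ^3 ≤ l := by rw [← hτl]; exact pow_le_pow_right₀ hτ1 (by norm_num)
    have e1 : 24 * u * n^3 ≤ c₁ * l := by
      calc 24 * u * n^3 ≤ (C * c₁) * u^2 * n^3 := by gcongr
        _ = c₁ * (C * u^2 * n^3) := by ring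
        _ ≤ c₁ * l := by gcongr
    calc 6 * (r*τ)^3 * r * (u * n * 4) = 24 * u * n * (r^2)^2 * τ^3 := by ring
      _ = (24 * u * n^3) * τ^3 := by rw [hrn]; ring
      _ ≤ (c₁ * l) * l := by gcongr
      _ = c₁ * l^2 := by ring
  · have e0 : 3 * (r*τ)^3 / (r*τ)^80 * (n^40 * m) = 3 * m * r^3 / τ^77 := by
      rw [← hrn]; field_simp
    rw [e0, div_div, div_le_div_iff₀ (by positivity) (by positivity)]
    have hτ77 : l ≤ τ^77 := by rw [← hτl]; exact pow_le_pow_right₀ hτ1 (by norm_num)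
    calc 3 * m * r^3 * (u * n * 4) = (12 * m) * (u * r^3 * n) := by ring
      _ ≤ (C * c₁) * (u^2 * n^2 * n) := by gcongr
      _ = c₁ * (C * u^2 * n^3) := by ring
      _ ≤ c₁ * τ^77 := by gcongr; linarith
  · have hlogl : Real.log l ≤ 40 * τ := by
      rw [← hτl, Real.log_pow]
      have := Real.log_le_sub_one_of_pos hτ
      push_cast; linarith
    have hloglnn : 0 ≤ Real.log l := Real.log_nonneg hl1
    have key : ∀ lam : ℝ, (lam = 1/(6*(r*τ)^3) ∨ lam = (c₁/(u*n))/(8*V)) →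
       5 * n * Real.log l ≤ lam * l * ((c₁/(u*n))/4) / 2 := by
      rintro lam (rfl | rfl)
      · have h36 := num36 (C' := 9600/c₁ + 1) (C := C) (u := u) (r := r) (τ := τ)
          (by have : 0 ≤ 9600/c₁ := by positivity
              linarith) q3 hr (by rw [hrn]; exact hnu) hτ (by rw [hrn, hτl]; exact hl')
        have h36' : 9600 * u * r^7 ≤ c₁ * τ^36 := by
          have : 9600/c₁ * u * r^7 ≤ τ^36 := by
            refine le_trans ?_ h36
            gcongr; linarith
          have := mul_le_mul_of_nonneg_left this hc.le
          have e : c₁ * (9600/c₁ * u * r^7) = 9600 * u * r^7 := by field_simp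
          linarith
        have e : 1/(6*(r*τ)^3) * l * ((c₁/(u*n))/4) / 2 = c₁ * τ^37 / (48 * u * n * r^3) := by
          rw [← hτl]; field_simp; ring
        rw [e, le_div_iff₀ (by positivity)]
        calc 5 * n * Real.log l * (48 * u * n * r^3) ≤ 5 * n * (40 * τ) * (48 * u * n * r^3) := by gcongr
          _ = 9600 * u * ((n^2) * r^3) * τ := by ring
          _ = (9600 * u * r^7) * τ := by rw [← hrn]; ring
          _ ≤ (c₁ * τ^36) * τ := by gcongr
          _ = c₁ * τ^37 := by ring
      · have hb := num5b (D := 320*V/c₁^2) (by positivity) q4 q5 (by linarith) hn1 hnu hlog hl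
        have e : (c₁/(u*n))/(8*V) * l * ((c₁/(u*n))/4) / 2 = (c₁^2/(64*V*u^2*n^2)) * l := by
          field_simp; ring
        rw [e]
        have := mul_le_mul_of_nonneg_left hb (by positivity : 0 ≤ c₁^2/(64*V*u^2*n^2))
        refine le_trans (le_of_eq ?_) this
        field_simp
        ring
    rcases min_choice (1/(6*(r*τ)^3)) ((c₁/(u*n))/(8*V)) with h | h
    · rw [h]; exact key _ (Or.inl rfl)
    · rw [h]; exact key _ (Or.inr rfl)

lemma final_exp {N L : ℕ} (hN : 1 ≤ N) (hL : 2 * N ≤ L) (hL3 : 3 ≤ L) {E : ℝ}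
    (hE : 5 * N * Real.log L ≤ E) :
    (N:ℝ) * (((2 * L^2 + 1 : ℕ) : ℝ) ^ N * (2 * Real.exp (-E))) ≤ 1 / L := by
  have hL0 : (0:ℝ) < L := by exact_mod_cast (by omega : 0 < L)
  have hL1 : (1:ℝ) ≤ L := by exact_mod_cast (by omega : 1 ≤ L)
  have h1 : Real.exp (-E) ≤ ((L:ℝ)^(5*N))⁻¹ := by
    rw [Real.exp_neg]
    apply inv_anti₀ (by positivity)
    have : (L:ℝ)^(5*N) = Real.exp (5 * N * Real.log L) := by
      have h := Real.exp_nat_mul (Real.log L) (5*N)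
      rw [Real.exp_log hL0] at h
      push_cast at h
      exact h.symm
    rw [this]; exact Real.exp_le_exp.mpr hE
  have h2 : ((2 * L^2 + 1 : ℕ) : ℝ) ≤ (L:ℝ)^3 := by
    have : 2 * L^2 + 1 ≤ L^3 := by nlinarith [Nat.pow_le_pow_left hL3 2]
    exact_mod_cast this
  have h3 : (2:ℝ) * N ≤ L := by exact_mod_cast hL
  calc (N:ℝ) * (((2 * L^2 + 1 : ℕ) : ℝ) ^ N * (2 * Real.exp (-E)))
      ≤ (N:ℝ) * (((L:ℝ)^3) ^ N * (2 * ((L:ℝ)^(5*N))⁻¹)) := by gcongr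
    _ = (2 * N) * (L:ℝ)^(3*N) * ((L:ℝ)^(5*N))⁻¹ := by rw [← pow_mul]; ring
    _ ≤ L * (L:ℝ)^(3*N) * ((L:ℝ)^(5*N))⁻¹ := by gcongr
    _ = (L:ℝ)^(3*N+1) / (L:ℝ)^(5*N) := by rw [div_eq_mul_inv]; ring
    _ ≤ 1 / L := by
      rw [div_le_div_iff₀ (by positivity) hL0, one_mul, ← pow_succ]
      exact pow_le_pow_right₀ hL1 (by omega)

lemma iter_norm_le (N L : ℕ) (ω : Fin L → Fin N → ℝ) (d₀ : Fin N → ℝ) (hd : ∑ i, d₀ i ^ 2 = 1) (t : ℕ) :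
    ∑ i, gpmIter N L ω d₀ t i ^ 2 ≤ 1 := by
  cases t with
  | zero => exact hd.le
  | succ t =>
    rw [gpmIter_succ]
    by_cases h : ∑ k, empG N L ω (gpmIter N L ω d₀ t) k ^ 2 = 0
    · simp [gpmStep, h]
    · exact (gpmStep_unit N L ω _ h).le

lemma limit_dist_le_two {N L : ℕ} {ω : Fin L → Fin N → ℝ} {d₀ r : Fin N → ℝ} (hd : ∑ i, d₀ i ^ 2 = 1)
    (hr : Tendsto (gpmIter N L ω d₀) atTop (𝓝 r)) (n : Fin N) {s : ℝ} (hs : s = 1 ∨ s = -1) :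
    Real.sqrt (∑ j, (r j - s * (if j = n then 1 else 0)) ^ 2) ≤ 2 := by
  have h1 : ∑ i, r i ^ 2 ≤ 1 := by
    have hc : Continuous fun d : Fin N → ℝ => ∑ i, d i ^ 2 := by fun_prop
    exact le_of_tendsto ((hc.tendsto r).comp hr) (Eventually.of_forall fun t => iter_norm_le N L ω d₀ hd t)
  have hs2 : s ^ 2 = 1 := by rcases hs with h | h <;> rw [h] <;> norm_num
  have h2 : ∑ j, (r j - s * (if j = n then 1 else 0)) ^ 2 ≤ ∑ j, (2 * r j ^ 2 + 2 * (if j = n then 1 else 0)) := by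
    apply Finset.sum_le_sum
    intro j _
    split_ifs
    · nlinarith [sq_nonneg (r j + s)]
    · nlinarith [sq_nonneg (r j)]
  have h3 : ∑ j, (2 * r j ^ 2 + 2 * (if j = n then (1:ℝ) else 0)) = 2 * ∑ j, r j ^ 2 + 2 := by
    rw [Finset.sum_add_distrib, ← Finset.mul_sum, ← Finset.mul_sum]; simp
  apply Real.sqrt_le_iff.mpr ⟨by norm_num, by linarith⟩

lemma prob_ge {Ω : Type*} [MeasurableSpace Ω] (μ : Measure Ω) [IsProbabilityMeasure μ] (S B Z : Set Ω)
    (hZ : μ Z = 0) {p : ℝ} (hB : μ.real B ≤ p) (h : Sᶜ ⊆ B ∪ Z) : μ S ≥ ENNReal.ofReal (1 - p) := by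
  have h1 : μ.real Z = 0 := by simp [Measure.real, hZ]
  have h2 : μ.real Sᶜ ≤ p := by
    calc μ.real Sᶜ ≤ μ.real (B ∪ Z) := measureReal_mono h
      _ ≤ μ.real B + μ.real Z := measureReal_union_le _ _
      _ ≤ p := by rw [h1]; linarith
  have h3 : (1:ℝ) ≤ μ.real S + μ.real Sᶜ := by
    have := measureReal_union_le (μ := μ) S Sᶜ
    rw [Set.union_compl_self] at this
    simpa using this
  apply ENNReal.ofReal_le_of_le_toReal
  change _ ≤ μ.real S
  linarith

theorem stmt13_main :
    ∃ c₃ > (0 : ℝ), ∃ C₃ > (0 : ℝ), ∃ c > (0 : ℝ),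
      ∀ (N L : ℕ) (θ ζ₀ ε : ℝ) (n : Fin N) (s : ℝ) (d₀ : Fin N → ℝ),
        1 / (N : ℝ) < θ → θ < (1 / 12) * Real.sqrt (π / 2) →
        ζ₀ ∈ Set.Ioo (0 : ℝ) 1 →
        (s = 1 ∨ s = -1) →
        goodSet N ζ₀ n s d₀ →
        0 < ε →
        ε < c₃ * (1 + ζ₀) * Real.sqrt N /
              (ζ₀ * θ ^ ((5 : ℝ) / 2) * (Real.log L * Real.log (N * L)) ^ ((3 : ℝ) / 2)) →
        (L : ℝ) ≥ C₃ * ((1 + ζ₀) / ζ₀) ^ 2 * ((N : ℝ) ^ 5 / (θ ^ 3 * ε ^ 2)) *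
              Real.log ((1 + ζ₀) * N / (ζ₀ * θ * ε)) →
        bgSamples θ N L
            {ω | ∃ r : Fin N → ℝ,
              Tendsto (gpmIter N L ω d₀) atTop (nhds r) ∧
              Real.sqrt (∑ j, (r j - s * (if j = n then 1 else 0)) ^ 2) ≤ ε} ≥
          ENNReal.ofReal (1 - c / (L : ℝ)) := by
  have hK3 := K3_pos
  have hM6 := M6_nonneg
  have hM80 := M80_nonneg
  obtain ⟨C, hC100, hC⟩ := numerics (3*K3/20) (9*M6+1) M80 (by positivity) (by positivity) hM80
  refine ⟨1, one_pos, C, by linarith, M80+1, by positivity, ?_⟩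
  intro N L θ ζ ε n s d₀ hNθ hθu hζ hs hd hε _ hL
  obtain ⟨hζ0, hζ1⟩ := hζ
  have hN0 : 0 < N := n.pos
  have hN1 : (1:ℝ) ≤ N := by exact_mod_cast hN0
  have hNr : (0:ℝ) < N := by linarith
  have hθ0 : 0 < θ := lt_trans (by positivity) hNθ
  have hθ5 : θ ≤ 1/5 := by
    have : Real.sqrt (π/2) ≤ 12/5 := Real.sqrt_le_iff.mpr ⟨by norm_num, by nlinarith [Real.pi_le_four]⟩
    linarith
  have hN5 : (5:ℝ) ≤ N := by
    rw [div_lt_iff₀ hNr] at hNθ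
    nlinarith
  have hprob := bgSamples_prob hθ0.le (by linarith : θ ≤ 1) N L
  have hconv := gpm_ae_converges θ N L d₀ hd.1
  by_cases hε2 : 2 ≤ ε
  · refine le_trans (ENNReal.ofReal_le_ofReal (?_ : _ ≤ (1:ℝ) - 0)) (prob_ge (bgSamples θ N L) _ ∅ _ hconv (p := 0) (by simp) ?_)
    · have : 0 ≤ (M80+1)/(L:ℝ) := by positivity
      linarith
    · intro ω hω
      right
      intro ⟨r, hr⟩
      exact hω ⟨r, hr, (limit_dist_le_two hd.1 hr n hs).trans hε2⟩
  push Not at hε2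
  set κ := (1+ζ)/ζ with hκ
  have hκ2 : 2 ≤ κ := by rw [hκ, le_div_iff₀ hζ0]; linarith
  have hue : (1 + ζ) * N / (ζ * θ * ε) = κ * N / (θ * ε) := by rw [hκ]; field_simp
  rw [hue] at hL
  set u := κ * N / (θ * ε) with hu
  have hθε : θ * ε ≤ 2/5 := by nlinarith
  have hθε0 : 0 < θ * ε := by positivity
  have huN : 5 * N ≤ u := by
    rw [hu, le_div_iff₀ hθε0]
    nlinarith
  have hu25 : 25 ≤ u := by linarith
  have hu0 : 0 < u := by linarith
  have hlog : 1 ≤ Real.log u := by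
    rw [Real.le_log_iff_exp_le hu0]
    have := Real.exp_one_lt_d9
    linarith
  have hL' : C * u^2 * (N:ℝ)^3 * Real.log u ≤ L := by
    have e : C * κ^2 * ((N:ℝ)^5/(θ^3*ε^2)) * Real.log u = C * u^2 * (N:ℝ)^3 * Real.log u / θ := by
      rw [hu]; field_simp
    have h0 : 0 ≤ C * u^2 * (N:ℝ)^3 * Real.log u := by positivity
    rw [e] at hL
    refine le_trans ?_ hL
    rw [le_div_iff₀ hθ0]
    nlinarith
  have hL100 : 100 * (N:ℝ) ≤ L := by
    refine le_trans ?_ hL'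
    have a1 : 1 ≤ u^2 := one_le_pow₀ (by linarith)
    have a2 : (N:ℝ) ≤ (N:ℝ)^3 := le_self_pow₀ hN1 (by norm_num)
    calc 100 * (N:ℝ) = 100 * 1 * N * 1 := by ring
      _ ≤ C * u^2 * (N:ℝ)^3 * Real.log u := by gcongr
  have hL100' : 100 * N ≤ L := by exact_mod_cast hL100
  have hL0 : (0:ℝ) < L := by linarith
  set τ := (L:ℝ)^((1:ℝ)/40) with hτ
  have hτ0 : 0 < τ := Real.rpow_pos_of_pos hL0 _
  have hτ40 : τ^40 = L := by
    rw [hτ, ← Real.rpow_natCast, ← Real.rpow_mul hL0.le]; norm_num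
  have hr1 : 1 ≤ Real.sqrt N := by rw [Real.one_le_sqrt]; exact hN1
  have hr2 : Real.sqrt N ^ 2 = N := Real.sq_sqrt hNr.le
  obtain ⟨n1, n2, n3⟩ := hC N L u (Real.sqrt N) τ hr1 hr2 (by linarith) hlog hτ0 hτ40 hL'
  set δ := (3*K3/20)/(u*N) with hδ
  have hδ0 : 0 < δ := by positivity
  set R := Real.sqrt N * τ with hR
  have hR0 : 0 < R := by positivity
  set lam := min (1/(6*R^3)) (δ/(8*(9*M6+1))) with hlam
  have hlam0 : 0 ≤ lam := by positivity
  have h3 : 2*(3*R^3)*lam ≤ 1 := by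
    have : lam ≤ 1/(6*R^3) := min_le_left _ _
    rw [le_div_iff₀ (by positivity)] at this
    linarith
  have h4 : lam*(9*M6) ≤ (δ/4)/2 := by
    have : lam ≤ δ/(8*(9*M6+1)) := min_le_right _ _
    rw [le_div_iff₀ (by positivity)] at this
    nlinarith
  have hLn : 0 < L := by omega
  have hcon := conc (M := L^2) (L := L) (N := N) (δ := δ) hθ0.le (by linarith : θ ≤ 1) (pow_pos hLn 2)
    (by omega) hR0 hlam0 (by push_cast; exact n1) n2 h3 h4
  have hfe := final_exp (N := N) (L := L) hN0 (by omega) (by omega) n3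
  have hR80 : (L:ℝ)*(M80*(N:ℝ)^40/R^80) = M80 / L := by
    have : R^80 = (N:ℝ)^40 * (L:ℝ)^2 := by
      calc R^80 = (Real.sqrt N ^ 2)^40 * (τ^40)^2 := by rw [hR]; ring
        _ = _ := by rw [hτ40, hr2]
    rw [this]; field_simp
  refine prob_ge (bgSamples θ N L) _ _ _ hconv (p := (M80+1)/(L:ℝ)) (hcon.trans ?_) ?_
  · rw [hR80, add_div]; linarith
  · intro ω hω
    by_contra hcc
    simp only [Set.mem_union, not_or] at hcc
    obtain ⟨hb, hz⟩ := hcc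
    have hb' := not_not.mp hb
    obtain ⟨r, hr⟩ := not_not.mp hz
    refine hω ⟨r, hr, ?_⟩
    refine dyn_limit (popProp hθ0.le hθ5 (3*K3) n) hθ0 (by positivity) hζ0 hζ1 hδ0.le hε hε2.le hs ?_ hb' hd hr
    apply le_of_eq
    rw [hδ, hu, ← hκ]
    have : 0 < κ := by linarith
    field_simp

/-- approximate recovery at Stage One: there are absolute constants
c₃, C₃, c > 0 such that for θ ∈ (1/N, (1/12)√(π/2)), ζ₀ ∈ (0,1), any initialization
d⁽⁰⁾ ∈ S_{ζ₀}^{(n±)}, any ε ∈ (0, c₃(1+ζ₀)√N/(ζ₀θ^{5/2}(log L · log(NL))^{3/2})) and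
any L ≥ C₃((1+ζ₀)/ζ₀)²(N⁵/(θ³ε²))log((1+ζ₀)N/(ζ₀θε)), with probability ≥ 1 − c/L the
GPM iterates converge to a point r with ‖r − (±e_n)‖ ≤ ε. -/
theorem stmt13 :
    ∃ c₃ > (0 : ℝ), ∃ C₃ > (0 : ℝ), ∃ c > (0 : ℝ),
      ∀ (N L : ℕ) (θ ζ₀ ε : ℝ) (n : Fin N) (s : ℝ) (d₀ : Fin N → ℝ),
        1 / (N : ℝ) < θ → θ < (1 / 12) * Real.sqrt (π / 2) →
        ζ₀ ∈ Set.Ioo (0 : ℝ) 1 →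
        (s = 1 ∨ s = -1) →
        goodSet N ζ₀ n s d₀ →
        0 < ε →
        ε < c₃ * (1 + ζ₀) * Real.sqrt N /
              (ζ₀ * θ ^ ((5 : ℝ) / 2) * (Real.log L * Real.log (N * L)) ^ ((3 : ℝ) / 2)) →
        (L : ℝ) ≥ C₃ * ((1 + ζ₀) / ζ₀) ^ 2 * ((N : ℝ) ^ 5 / (θ ^ 3 * ε ^ 2)) *
              Real.log ((1 + ζ₀) * N / (ζ₀ * θ * ε)) →
        bgSamples θ N L
            {ω | ∃ r : Fin N → ℝ,
              Tendsto (gpmIter N L ω d₀) atTop (nhds r) ∧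
              Real.sqrt (∑ j, (r j - s * (if j = n then 1 else 0)) ^ 2) ≤ ε} ≥
          ENNReal.ofReal (1 - c / (L : ℝ)) := by
  exact stmt13_main
end

section
/- (GPM is Riemannian gradient descent with adaptive step size.) Let d ∈ ℝ^N be a unit vector and g ∈ ℝ^N a vector with dᵀg ≠ 0, and set τ = −1/(dᵀ g). Then d − τ (I − d dᵀ) g = g/(dᵀ g). Consequently, if in addition dᵀ g < 0 and g ≠ 0, the normalization onto the unit sphere of d − τ (I − d dᵀ) g equals −g/‖g‖; i.e., a Riemannian gradient descent step with step size τ = −1/(dᵀ∇f(d)) followed by projection onto the sphere coincides with the generalized power method update d⁺ = −∇f(d)/‖∇f(d)‖. -/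
/-- A Riemannian gradient descent step on the sphere with adaptive step
size τ = −1/(dᵀg) satisfies d − τ(I − ddᵀ)g = g/(dᵀg); if moreover dᵀg < 0 and g ≠ 0,
its normalization onto the unit sphere equals −g/‖g‖ (the GPM update). -/
theorem stmt17 (N : ℕ) (d g : Fin N → ℝ)
    (hd : ∑ i, d i ^ 2 = 1) (hdg : (∑ i, d i * g i) ≠ 0)
    (τ : ℝ) (hτ : τ = -(∑ i, d i * g i)⁻¹) :
    (∀ j, d j - τ * (g j - d j * ∑ i, d i * g i) = g j / (∑ i, d i * g i)) ∧
    ((∑ i, d i * g i) < 0 → g ≠ 0 → ∀ j,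
      (d j - τ * (g j - d j * ∑ i, d i * g i)) /
          Real.sqrt (∑ k, (d k - τ * (g k - d k * ∑ i, d i * g i)) ^ 2) =
        -(g j / Real.sqrt (∑ k, g k ^ 2))) := by
  generalize (∑ i, d i * g i) = s at *
  have h1 : ∀ j, d j - τ * (g j - d j * s) = g j / s := by
    intro j
    subst hτ
    field_simp
    ring
  refine ⟨h1, fun hs _ j => ?_⟩
  simp only [h1, div_pow]
  rw [← Finset.sum_div, Real.sqrt_div' _ (sq_nonneg s), Real.sqrt_sq_eq_abs, abs_of_neg hs,
    div_neg, div_neg, div_div_div_cancel_right₀ hdg]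
end
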